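/- arXiv:1706.03654 — 6 statements merged into one kernel-verified Lean document; each statement's English description precedes it below -/
import Mathlib

section
/- Let (\Omega, \mathcal{F}, \mu) be a probability space, (\mathcal{F}_n)_{n\ge 0} a filtration, and 1 < p \le 2. Let (\Phi_n)_{n\ge 0} be a martingale with respect to (\mathcal{F}_n) that is bounded in L^p, i.e. \sup_n \|\Phi_n\|_{L^p(\mu)} < \infty. Set h_n = \Phi_n - \Phi_{n-1} for n \ge 1. Then the sequence (\|h_n\|_{L^p(\mu)})_{n\ge 1} belongs to \ell_2, i.e. \sum_{n=1}^{\infty} \|h_n\|_{L^p(\mu)}^2 < \infty. -/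
open MeasureTheory

/-- Concavity of `t ↦ t ^ (p - 1)`: its increments on `[0, M]` dominate those of the linear map
of slope `(p - 1) * M ^ (p - 2)`. -/
lemma mul_sub_le_rpow_sub_rpow {p M s t : ℝ} (hp1 : 1 < p) (hp2 : p ≤ 2)
    (hs : 0 ≤ s) (hst : s ≤ t) (htM : t ≤ M) :
    (p - 1) * M ^ (p - 2) * (t - s) ≤ t ^ (p - 1) - s ^ (p - 1) := by
  rcases (hs.trans hst).eq_or_lt with rfl | ht
  · obtain rfl : s = 0 := le_antisymm hst hs
    simp
  have hbern : (s / t) ^ (p - 1) ≤ 1 + (p - 1) * (s / t - 1) := by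
    have := rpow_one_add_le_one_add_mul_self (s := s / t - 1) (p := p - 1)
      (by have := div_nonneg hs ht.le; linarith) (by linarith) (by linarith)
    simpa using this
  have hMt : M ^ (p - 2) ≤ t ^ (p - 2) :=
    Real.rpow_le_rpow_of_nonpos ht htM (by linarith)
  have htp : t ^ (p - 1) = t ^ (p - 2) * t := by
    rw [← Real.rpow_add_one ht.ne']; ring_nf
  rw [Real.div_rpow hs ht.le, div_le_iff₀ (Real.rpow_pos_of_pos ht _)] at hbern
  have htangent : (1 + (p - 1) * (s / t - 1)) * t ^ (p - 1)
      = t ^ (p - 1) - (p - 1) * t ^ (p - 2) * (t - s) := by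
    rw [htp]; field_simp; ring
  rw [htangent] at hbern
  have : (p - 1) * M ^ (p - 2) * (t - s) ≤ (p - 1) * t ^ (p - 2) * (t - s) := by
    gcongr
  linarith

/-- The signed power `|t| ^ (p - 2) * t` equals `t ^ (p - 1)` for nonnegative `t`. -/
lemma abs_rpow_sub_two_mul_self {p t : ℝ} (hp1 : 1 < p) (ht : 0 ≤ t) :
    |t| ^ (p - 2) * t = t ^ (p - 1) := by
  rcases ht.eq_or_lt with rfl | ht
  · simp [Real.zero_rpow (by linarith : p - 1 ≠ 0)]
  · rw [abs_of_pos ht, ← Real.rpow_add_one ht.ne']; ring_nf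

/-- On `[-M, M]` the increments of the signed power `|t| ^ (p - 2) * t` dominate those of the
linear map of slope `(p - 1) * M ^ (p - 2)`. -/
lemma mul_sub_le_signed_rpow_sub {p M s t : ℝ} (hp1 : 1 < p) (hp2 : p ≤ 2)
    (hs : -M ≤ s) (hst : s ≤ t) (htM : t ≤ M) :
    (p - 1) * M ^ (p - 2) * (t - s) ≤ |t| ^ (p - 2) * t - |s| ^ (p - 2) * s := by
  have hneg : ∀ u : ℝ, u ≤ 0 → |u| ^ (p - 2) * u = -(-u) ^ (p - 1) := by
    intro u hu
    rw [← abs_rpow_sub_two_mul_self hp1 (neg_nonneg.2 hu), abs_neg]; ring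
  have hzero : (0 : ℝ) ^ (p - 1) = 0 := Real.zero_rpow (by linarith)
  rcases le_total 0 s with h0s | hs0
  · rw [abs_rpow_sub_two_mul_self hp1 h0s, abs_rpow_sub_two_mul_self hp1 (h0s.trans hst)]
    exact mul_sub_le_rpow_sub_rpow hp1 hp2 h0s hst htM
  rcases le_total 0 t with h0t | ht0
  · rw [abs_rpow_sub_two_mul_self hp1 h0t, hneg s hs0]
    have h₁ := mul_sub_le_rpow_sub_rpow hp1 hp2 le_rfl h0t htM
    have h₂ := mul_sub_le_rpow_sub_rpow hp1 hp2 le_rfl (neg_nonneg.2 hs0)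
      (by linarith : -s ≤ M)
    rw [hzero] at h₁ h₂
    linarith
  · rw [hneg t ht0, hneg s hs0]
    have := mul_sub_le_rpow_sub_rpow hp1 hp2 (neg_nonneg.2 ht0) (neg_le_neg hst)
      (by linarith : -s ≤ M)
    linarith

/-- Bregman divergence of `|·| ^ p` on the real line. -/
noncomputable def absRpowBregman (p x y : ℝ) : ℝ :=
  |y| ^ p - |x| ^ p - p * (|x| ^ (p - 2) * x * (y - x))

lemma absRpowBregman_neg (p x y : ℝ) :
    absRpowBregman p (-x) (-y) = absRpowBregman p x y := by
  simp only [absRpowBregman, abs_neg]; ring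

/-- Quadratic lower bound for the Bregman divergence of `|·| ^ p`. -/
lemma mul_sq_le_absRpowBregman {p M x y : ℝ} (hp1 : 1 < p) (hp2 : p ≤ 2)
    (hx : |x| ≤ M) (hy : |y| ≤ M) :
    p * (p - 1) / 2 * (M ^ (p - 2) * (y - x) ^ 2) ≤ absRpowBregman p x y := by
  wlog hxy : x < y generalizing x y
  · rcases (not_lt.1 hxy).eq_or_lt with rfl | hyx
    · simp [absRpowBregman]
    · rw [← absRpowBregman_neg]
      convert this (x := -x) (y := -y) (by simpa using hx) (by simpa using hy)
        (by linarith) using 3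
      ring
  let g : ℝ → ℝ := fun t => |t| ^ p - p * (p - 1) / 2 * M ^ (p - 2) * t ^ 2
  let g' : ℝ → ℝ := fun t => p * |t| ^ (p - 2) * t - p * (p - 1) / 2 * M ^ (p - 2) * (2 * t)
  have hg : ∀ t, HasDerivAt g (g' t) t := by
    intro t
    have hsq : HasDerivAt (fun t : ℝ => t ^ 2) (2 * t) t := by
      simpa using hasDerivAt_pow 2 t
    exact (hasDerivAt_abs_rpow t hp1).sub (hsq.const_mul _)
  obtain ⟨c, ⟨hxc, hcy⟩, hc⟩ := exists_hasDerivAt_eq_slope g g' hxy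
    (fun t _ => (hg t).continuousAt.continuousWithinAt) (fun t _ => hg t)
  rw [eq_div_iff (sub_pos.2 hxy).ne'] at hc
  have hmono := mul_sub_le_signed_rpow_sub hp1 hp2 (abs_le.1 hx).1 hxc.le
    (hcy.le.trans (abs_le.1 hy).2)
  have hg'_le : g' x ≤ g' c := by
    have := mul_le_mul_of_nonneg_left hmono (by linarith : 0 ≤ p)
    simp only [g']
    linarith
  have := mul_le_mul_of_nonneg_right hg'_le (sub_pos.2 hxy).le
  rw [hc] at this
  simp only [g, g'] at this
  simp only [absRpowBregman]
  linarith

lemma absRpowBregman_nonneg {p : ℝ} (hp1 : 1 < p) (hp2 : p ≤ 2) (x y : ℝ) :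
    0 ≤ absRpowBregman p x y := by
  refine le_trans ?_ (mul_sq_le_absRpowBregman hp1 hp2 (le_max_left |x| |y|) (le_max_right _ _))
  have : 0 < p - 1 := by linarith
  positivity

/-- Interpolation bound for increments in terms of the Bregman divergence of `|·| ^ p`. -/
lemma abs_sub_rpow_le {p : ℝ} (hp1 : 1 < p) (hp2 : p ≤ 2) (x y : ℝ) :
    |y - x| ^ p ≤ (2 / (p * (p - 1)) * absRpowBregman p x y) ^ (p / 2)
      * (|x| ^ p + |y| ^ p) ^ (1 - p / 2) := by
  have hq : 0 < p - 1 := by linarith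
  have hD := absRpowBregman_nonneg hp1 hp2 x y
  set M := max |x| |y| with hM
  have hM0 : 0 ≤ M := (abs_nonneg x).trans (le_max_left _ _)
  rcases hM0.eq_or_lt with h0 | hMpos
  · have hx : x = 0 := abs_nonpos_iff.1 (h0 ▸ le_max_left _ _)
    have hy : y = 0 := abs_nonpos_iff.1 (h0 ▸ le_max_right _ _)
    have : |y - x| ^ p = 0 := by
      rw [hx, hy]; simp [Real.zero_rpow (by linarith : p ≠ 0)]
    rw [this]
    positivity
  have hquad : M ^ (p - 2) * (y - x) ^ 2 ≤ 2 / (p * (p - 1)) * absRpowBregman p x y := by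
    have h := mul_sq_le_absRpowBregman hp1 hp2 (le_max_left |x| |y|) (le_max_right _ _)
    rw [← hM] at h
    calc M ^ (p - 2) * (y - x) ^ 2
        = 2 / (p * (p - 1)) * (p * (p - 1) / 2 * (M ^ (p - 2) * (y - x) ^ 2)) := by
          field_simp
      _ ≤ _ := by gcongr
  have hMp : M ^ p ≤ |x| ^ p + |y| ^ p := by
    rcases max_choice |x| |y| with h | h <;> rw [hM, h]
    · exact le_add_of_nonneg_right (by positivity)
    · exact le_add_of_nonneg_left (by positivity)
  calc |y - x| ^ p
      = (M ^ (p - 2) * (y - x) ^ 2) ^ (p / 2) * (M ^ p) ^ (1 - p / 2) := by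
        rw [Real.mul_rpow (by positivity) (by positivity), ← Real.rpow_mul hM0,
          ← Real.rpow_mul hM0, ← sq_abs, ← Real.rpow_natCast, ← Real.rpow_mul (abs_nonneg _),
          mul_right_comm, ← Real.rpow_add hMpos]
        have h₁ : (p - 2) * (p / 2) + p * (1 - p / 2) = 0 := by ring
        have h₂ : ((2 : ℕ) : ℝ) * (p / 2) = p := by push_cast; ring
        rw [h₁, h₂, Real.rpow_zero, one_mul]
    _ ≤ _ := by
        gcongr
        linarith

section Integral

variable {Ω : Type*} {m : MeasurableSpace Ω} {μ : Measure Ω} {p : ℝ} {X Y : Ω → ℝ}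

lemma integrable_abs_rpow (hp1 : 1 < p) (hX : MemLp X (ENNReal.ofReal p) μ) :
    Integrable (fun ω => |X ω| ^ p) μ := by
  have := hX.integrable_norm_rpow (by simp; linarith) ENNReal.ofReal_ne_top
  simpa [ENNReal.toReal_ofReal (by linarith : 0 ≤ p)] using this

lemma integrable_signed_rpow_mul (hp1 : 1 < p) (hX : MemLp X (ENNReal.ofReal p) μ)
    (hY : MemLp Y (ENNReal.ofReal p) μ) :
    Integrable (fun ω => |X ω| ^ (p - 2) * X ω * Y ω) μ := by
  refine ((integrable_abs_rpow hp1 hX).add (integrable_abs_rpow hp1 hY)).mono' ?_ ?_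
  · have hXm := hX.aestronglyMeasurable.aemeasurable
    have hYm := hY.aestronglyMeasurable.aemeasurable
    exact (((hXm.abs.pow_const _).mul hXm).mul hYm).aestronglyMeasurable
  · refine Filter.Eventually.of_forall fun ω => ?_
    have hsigned : ‖|X ω| ^ (p - 2) * X ω * Y ω‖ = |X ω| ^ (p - 1) * |Y ω| := by
      rw [← abs_rpow_sub_two_mul_self hp1 (abs_nonneg (X ω)), norm_mul, norm_mul, abs_abs]
      simp [abs_of_nonneg (Real.rpow_nonneg (abs_nonneg (X ω)) _)]
    rw [hsigned, Pi.add_apply]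
    have hpow : ∀ a : ℝ, 0 ≤ a → a ^ (p - 1) * a = a ^ p := by
      intro a ha
      rw [← Real.rpow_add_one' ha (by linarith)]; ring_nf
    rcases le_total |X ω| |Y ω| with h | h
    · calc |X ω| ^ (p - 1) * |Y ω| ≤ |Y ω| ^ (p - 1) * |Y ω| := by gcongr
        _ = |Y ω| ^ p := hpow _ (abs_nonneg _)
        _ ≤ _ := le_add_of_nonneg_left (by positivity)
    · calc |X ω| ^ (p - 1) * |Y ω| ≤ |X ω| ^ (p - 1) * |X ω| := by gcongr
        _ = |X ω| ^ p := hpow _ (abs_nonneg _)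
        _ ≤ _ := le_add_of_nonneg_right (by positivity)

lemma integrable_absRpowBregman (hp1 : 1 < p) (hX : MemLp X (ENNReal.ofReal p) μ)
    (hY : MemLp Y (ENNReal.ofReal p) μ) :
    Integrable (fun ω => absRpowBregman p (X ω) (Y ω)) μ :=
  ((integrable_abs_rpow hp1 hY).sub (integrable_abs_rpow hp1 hX)).sub
    ((integrable_signed_rpow_mul hp1 hX (hY.sub hX)).const_mul p)

/-- For a one-step martingale `(X, Y)`, the expected Bregman divergence is the increment of the
`p`-th absolute moment. -/
lemma integral_absRpowBregman_of_condExp_eq [IsFiniteMeasure μ] {m₀ : MeasurableSpace Ω}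
    (hm : m₀ ≤ m) (hp1 : 1 < p)
    (hXm : StronglyMeasurable[m₀] X) (hX : MemLp X (ENNReal.ofReal p) μ)
    (hY : MemLp Y (ENNReal.ofReal p) μ) (hXY : μ[Y | m₀] =ᵐ[μ] X) :
    ∫ ω, absRpowBregman p (X ω) (Y ω) ∂μ = ∫ ω, |Y ω| ^ p ∂μ - ∫ ω, |X ω| ^ p ∂μ := by
  have hp : (1 : ENNReal) ≤ ENNReal.ofReal p := by simpa using hp1.le
  have hXi : Integrable X μ := hX.integrable hp
  have hYi : Integrable Y μ := hY.integrable hp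
  have hint : Integrable (fun ω => |X ω| ^ (p - 2) * X ω * (Y ω - X ω)) μ :=
    integrable_signed_rpow_mul hp1 hX (hY.sub hX)
  have hSm : StronglyMeasurable[m₀] (fun ω => |X ω| ^ (p - 2) * X ω) := by
    have := hXm.measurable
    exact ((this.abs.pow_const _).mul this).stronglyMeasurable
  have hzero : ∫ ω, |X ω| ^ (p - 2) * X ω * (Y ω - X ω) ∂μ = 0 := by
    have hpull := condExp_mul_of_stronglyMeasurable_left (g := Y - X) hSm hint (hYi.sub hXi)
    have hdiff : μ[Y - X | m₀] =ᵐ[μ] 0 := by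
      filter_upwards [condExp_sub hYi hXi m₀, hXY] with ω h₁ h₂
      rw [h₁, Pi.sub_apply, h₂, condExp_of_stronglyMeasurable hm hXm hXi]
      simp
    have h := integral_condExp (μ := μ) hm
      (f := (fun ω => |X ω| ^ (p - 2) * X ω) * (Y - X))
    have h0 : μ[(fun ω => |X ω| ^ (p - 2) * X ω) * (Y - X) | m₀] =ᵐ[μ] 0 := by
      filter_upwards [hpull, hdiff] with ω h₁ h₂
      rw [h₁, Pi.mul_apply, h₂]
      simp
    rw [integral_congr_ae h0] at h
    simpa using h.symm
  have hXp := integrable_abs_rpow hp1 hX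
  have hYp := integrable_abs_rpow hp1 hY
  simp only [absRpowBregman]
  rw [integral_sub (by fun_prop) (hint.const_mul p), integral_sub hYp hXp,
    integral_const_mul, hzero, mul_zero, sub_zero]

/-- The squared `L^p` norm of a difference is controlled by the mean Bregman divergence. -/
lemma eLpNorm_sub_toReal_sq_le (hp1 : 1 < p) (hp2 : p ≤ 2)
    (hX : MemLp X (ENNReal.ofReal p) μ) (hY : MemLp Y (ENNReal.ofReal p) μ) :
    (eLpNorm (fun ω => Y ω - X ω) (ENNReal.ofReal p) μ).toReal ^ 2
      ≤ 2 / (p * (p - 1)) * (∫ ω, absRpowBregman p (X ω) (Y ω) ∂μ)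
        * (∫ ω, |X ω| ^ p ∂μ + ∫ ω, |Y ω| ^ p ∂μ) ^ (2 / p - 1) := by
  have hp0 : 0 < p := by linarith
  have hq : 0 < p - 1 := by linarith
  have hXp := integrable_abs_rpow hp1 hX
  have hYp := integrable_abs_rpow hp1 hY
  have hSi : Integrable (fun ω => |X ω| ^ p + |Y ω| ^ p) μ := hXp.add hYp
  have hDi := (integrable_absRpowBregman hp1 hX hY).const_mul (2 / (p * (p - 1)))
  have hDnn : ∀ ω, 0 ≤ 2 / (p * (p - 1)) * absRpowBregman p (X ω) (Y ω) := fun ω =>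
    mul_nonneg (by positivity) (absRpowBregman_nonneg hp1 hp2 _ _)
  have hSnn : ∀ ω, 0 ≤ |X ω| ^ p + |Y ω| ^ p := fun ω => by positivity
  set A := ∫ ω, 2 / (p * (p - 1)) * absRpowBregman p (X ω) (Y ω) ∂μ
  set B := ∫ ω, |X ω| ^ p + |Y ω| ^ p ∂μ
  have hA0 : 0 ≤ A := integral_nonneg hDnn
  have hB0 : 0 ≤ B := integral_nonneg hSnn
  have hholder : ∫⁻ ω, ‖Y ω - X ω‖ₑ ^ p ∂μ ≤ ENNReal.ofReal (A ^ (p / 2) * B ^ (1 - p / 2)) := by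
    calc ∫⁻ ω, ‖Y ω - X ω‖ₑ ^ p ∂μ
        ≤ ∫⁻ ω, ENNReal.ofReal (2 / (p * (p - 1)) * absRpowBregman p (X ω) (Y ω)) ^ (p / 2)
            * ENNReal.ofReal (|X ω| ^ p + |Y ω| ^ p) ^ (1 - p / 2) ∂μ := by
          refine lintegral_mono fun ω => ?_
          rw [ENNReal.ofReal_rpow_of_nonneg (hDnn ω) (by linarith),
            ENNReal.ofReal_rpow_of_nonneg (hSnn ω) (by linarith),
            ← ENNReal.ofReal_mul (Real.rpow_nonneg (hDnn ω) _), Real.enorm_eq_ofReal_abs,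
            ENNReal.ofReal_rpow_of_nonneg (abs_nonneg _) hp0.le]
          exact ENNReal.ofReal_le_ofReal (abs_sub_rpow_le hp1 hp2 _ _)
      _ ≤ (∫⁻ ω, ENNReal.ofReal (2 / (p * (p - 1)) * absRpowBregman p (X ω) (Y ω)) ∂μ) ^ (p / 2)
            * (∫⁻ ω, ENNReal.ofReal (|X ω| ^ p + |Y ω| ^ p) ∂μ) ^ (1 - p / 2) :=
          ENNReal.lintegral_mul_norm_pow_le hDi.aestronglyMeasurable.aemeasurable.ennreal_ofReal
            hSi.aestronglyMeasurable.aemeasurable.ennreal_ofReal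
            (by linarith) (by linarith) (by ring)
      _ = _ := by
          rw [← ofReal_integral_eq_lintegral_ofReal hDi (Filter.Eventually.of_forall hDnn),
            ← ofReal_integral_eq_lintegral_ofReal hSi (Filter.Eventually.of_forall hSnn),
            ENNReal.ofReal_rpow_of_nonneg hA0 (by linarith),
            ENNReal.ofReal_rpow_of_nonneg hB0 (by linarith),
            ← ENNReal.ofReal_mul (by positivity)]
  have hnorm : (eLpNorm (fun ω => Y ω - X ω) (ENNReal.ofReal p) μ).toReal
      ≤ (A ^ (p / 2) * B ^ (1 - p / 2)) ^ (1 / p) := by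
    rw [eLpNorm_eq_lintegral_rpow_enorm_toReal (by simpa using hp0) ENNReal.ofReal_ne_top,
      ENNReal.toReal_ofReal hp0.le]
    refine ENNReal.toReal_le_of_le_ofReal (by positivity) ?_
    rw [← ENNReal.ofReal_rpow_of_nonneg (by positivity) (by positivity)]
    gcongr
  rw [← integral_const_mul, ← integral_add hXp hYp]
  calc _ ≤ ((A ^ (p / 2) * B ^ (1 - p / 2)) ^ (1 / p)) ^ 2 := by gcongr
    _ = A * B ^ (2 / p - 1) := by
      rw [← Real.rpow_natCast, ← Real.rpow_mul (by positivity),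
        Real.mul_rpow (by positivity) (by positivity), ← Real.rpow_mul hA0, ← Real.rpow_mul hB0]
      have h₁ : p / 2 * (1 / p * ((2 : ℕ) : ℝ)) = 1 := by push_cast; field_simp
      have h₂ : (1 - p / 2) * (1 / p * ((2 : ℕ) : ℝ)) = 2 / p - 1 := by push_cast; field_simp
      rw [h₁, h₂, Real.rpow_one]

lemma integral_abs_rpow_le_of_eLpNorm_le (hp1 : 1 < p) {C : ℝ}
    (hX : MemLp X (ENNReal.ofReal p) μ)
    (hC : eLpNorm X (ENNReal.ofReal p) μ ≤ ENNReal.ofReal C) :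
    ∫ ω, |X ω| ^ p ∂μ ≤ (max C 0) ^ p := by
  have hp0 : 0 < p := by linarith
  have hC' : eLpNorm X (ENNReal.ofReal p) μ ≤ ENNReal.ofReal (max C 0) :=
    hC.trans (ENNReal.ofReal_le_ofReal (le_max_left _ _))
  have hI : 0 ≤ ∫ ω, |X ω| ^ p ∂μ := integral_nonneg fun ω => by positivity
  rw [hX.eLpNorm_eq_integral_rpow_norm (by simpa using hp0) ENNReal.ofReal_ne_top,
    ENNReal.toReal_ofReal hp0.le, ENNReal.ofReal_le_ofReal_iff (le_max_right _ _)] at hC'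
  simp only [Real.norm_eq_abs] at hC'
  rwa [Real.rpow_inv_le_iff_of_pos hI (le_max_right _ _) hp0] at hC'

end Integral

/-- **Katznelson–Ornstein.** If `(Φₙ)` is an `L^p`-bounded martingale on a
probability space, with `1 < p ≤ 2`, then the sequence of `L^p`-norms of its martingale
differences `hₙ = Φₙ - Φₙ₋₁` is square-summable. -/
theorem martingale_differences_l2
    {Ω : Type*} {m : MeasurableSpace Ω} (μ : Measure Ω) [IsProbabilityMeasure μ]
    (ℱ : Filtration ℕ m)
    (p : ℝ) (hp1 : 1 < p) (hp2 : p ≤ 2)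
    (Φ : ℕ → Ω → ℝ) (hmart : Martingale Φ ℱ μ)
    (C : ℝ)
    (hbdd : ∀ n, eLpNorm (Φ n) (ENNReal.ofReal p) μ ≤ ENNReal.ofReal C) :
    Summable (fun n =>
      ((eLpNorm (fun ω => Φ (n + 1) ω - Φ n ω) (ENNReal.ofReal p) μ).toReal) ^ 2) := by
  have hmem : ∀ n, MemLp (Φ n) (ENNReal.ofReal p) μ := fun n =>
    ⟨(hmart.integrable n).aestronglyMeasurable, (hbdd n).trans_lt ENNReal.ofReal_lt_top⟩
  set a : ℕ → ℝ := fun n => ∫ ω, |Φ n ω| ^ p ∂μ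
  set B : ℝ := (max C 0) ^ p
  have ha0 : ∀ n, 0 ≤ a n := fun n => integral_nonneg fun ω => by positivity
  have haB : ∀ n, a n ≤ B := fun n => integral_abs_rpow_le_of_eLpNorm_le hp1 (hmem n) (hbdd n)
  have hq : 0 < p - 1 := by linarith
  have hexp : 0 ≤ 2 / p - 1 := by
    rw [sub_nonneg, le_div_iff₀ (by linarith)]; linarith
  set K : ℝ := 2 / (p * (p - 1)) * (2 * B) ^ (2 / p - 1) with hK
  have hB0 : 0 ≤ B := (ha0 0).trans (haB 0)
  have hK0 : 0 ≤ K := by positivity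
  have hstep : ∀ n, (eLpNorm (fun ω => Φ (n + 1) ω - Φ n ω) (ENNReal.ofReal p) μ).toReal ^ 2
      ≤ K * (a (n + 1) - a n) := by
    intro n
    have hD := integral_absRpowBregman_of_condExp_eq (ℱ.le n) hp1 (hmart.stronglyMeasurable n)
      (hmem n) (hmem (n + 1)) (hmart.condExp_ae_eq n.le_succ)
    have hD0 : 0 ≤ a (n + 1) - a n :=
      hD ▸ integral_nonneg fun ω => absRpowBregman_nonneg hp1 hp2 _ _
    refine (eLpNorm_sub_toReal_sq_le hp1 hp2 (hmem n) (hmem (n + 1))).trans ?_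
    rw [hD]
    calc 2 / (p * (p - 1)) * (a (n + 1) - a n) * (a n + a (n + 1)) ^ (2 / p - 1)
        ≤ 2 / (p * (p - 1)) * (a (n + 1) - a n) * (2 * B) ^ (2 / p - 1) := by
          have := ha0 n
          have := ha0 (n + 1)
          gcongr
          linarith [haB n, haB (n + 1)]
      _ = K * (a (n + 1) - a n) := by rw [hK]; ring
  refine summable_of_sum_range_le (c := K * B) (fun n => sq_nonneg _) fun n => ?_
  calc _ ≤ ∑ i ∈ Finset.range n, K * (a (i + 1) - a i) := Finset.sum_le_sum fun i _ => hstep i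
    _ = K * (a n - a 0) := by rw [← Finset.mul_sum, Finset.sum_range_sub]
    _ ≤ K * B := by
      gcongr
      linarith [ha0 0, haB n]
end

section
/- Let (\Omega, \mathcal{F}, \mu) be a probability space, (\mathcal{F}_n)_{n\ge 0} a filtration, 1 < p \le 2, and let (\Phi_n)_{n\ge 0} be a martingale with respect to (\mathcal{F}_n) with \sup_n \|\Phi_n\|_{L^p(\mu)} < \infty; set h_n = \Phi_n - \Phi_{n-1}. Let \lambda \in (0,1) and define \eta_n = \sum_{m=n}^{\infty} \lambda^{m-n} \|h_m\|_{L^p(\mu)} for n \ge 1. Then \sum_{n=1}^{\infty} \eta_n^2 < \infty. -/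
open MeasureTheory

lemma hasDerivAt_rpow_sub_sq (p : ℝ) {u : ℝ} (hu : 0 < u) :
    HasDerivAt (fun u : ℝ => u ^ p - p * (p - 1) / 2 * u ^ 2)
      (p * u ^ (p - 1) - p * (p - 1) * u) u := by
  have h := (Real.hasDerivAt_rpow_const (p := p) (Or.inl hu.ne')).sub
    ((hasDerivAt_pow 2 u).const_mul (p * (p - 1) / 2))
  refine h.congr_deriv ?_
  simp only [Nat.cast_ofNat, Nat.add_one_sub_one, pow_one]
  ring

lemma continuous_rpow_sub_sq {p : ℝ} (hp1 : 1 < p) :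
    Continuous (fun u : ℝ => u ^ p - p * (p - 1) / 2 * u ^ 2) := by
  have : Continuous (fun u : ℝ => u ^ p) := Real.continuous_rpow_const (by linarith)
  fun_prop

lemma monotoneOn_rpow_sub_sq {p : ℝ} (hp1 : 1 < p) (hp2 : p ≤ 2) :
    MonotoneOn (fun u : ℝ => u ^ p - p * (p - 1) / 2 * u ^ 2) (Set.Icc 0 1) := by
  refine monotoneOn_of_hasDerivWithinAt_nonneg (f' := fun u => p * u ^ (p - 1) - p * (p - 1) * u)
    (convex_Icc 0 1)
    (continuous_rpow_sub_sq hp1).continuousOn (fun u hu => ?_) (fun u hu => ?_)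
  all_goals rw [interior_Icc] at hu
  · exact (hasDerivAt_rpow_sub_sq p hu.1).hasDerivWithinAt
  · have h : u ^ (1 : ℝ) ≤ u ^ (p - 1) :=
      Real.rpow_le_rpow_of_exponent_ge hu.1 hu.2.le (by linarith)
    rw [Real.rpow_one] at h
    have h0 : (p - 1) * u ≤ 1 * u := mul_le_mul_of_nonneg_right (by linarith) hu.1.le
    have h1 : p * ((p - 1) * u) ≤ p * u ^ (p - 1) :=
      mul_le_mul_of_nonneg_left (by linarith) (by linarith)
    linarith

lemma convexOn_rpow_sub_sq {p : ℝ} (hp1 : 1 < p) (hp2 : p ≤ 2) :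
    ConvexOn ℝ (Set.Icc 0 1) (fun u : ℝ => u ^ p - p * (p - 1) / 2 * u ^ 2) := by
  refine convexOn_of_hasDerivWithinAt2_nonneg (f' := fun u => p * u ^ (p - 1) - p * (p - 1) * u)
    (f'' := fun u => p * (p - 1) * (u ^ (p - 2) - 1))
    (convex_Icc 0 1)
    (continuous_rpow_sub_sq hp1).continuousOn (fun u hu => ?_) (fun u hu => ?_) (fun u hu => ?_)
  all_goals rw [interior_Icc] at hu
  · exact (hasDerivAt_rpow_sub_sq p hu.1).hasDerivWithinAt
  · have h := ((Real.hasDerivAt_rpow_const (p := p - 1) (Or.inl hu.1.ne')).const_mul p).sub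
      ((hasDerivAt_id u).const_mul (p * (p - 1)))
    refine (h.congr_deriv ?_).hasDerivWithinAt
    rw [show p - 1 - 1 = p - 2 by ring]
    ring
  · have h : 1 ≤ u ^ (p - 2) :=
      Real.one_le_rpow_of_pos_of_le_one_of_nonpos hu.1 hu.2.le (by linarith)
    exact mul_nonneg (mul_nonneg (by linarith) (by linarith)) (by linarith)

/-- The function `|u| ^ p` is strongly convex on `[-1, 1]` for `1 < p ≤ 2`. -/
lemma convexOn_abs_rpow_sub_sq {p : ℝ} (hp1 : 1 < p) (hp2 : p ≤ 2) :
    ConvexOn ℝ (Set.Icc (-1) 1) (fun u : ℝ => |u| ^ p - p * (p - 1) / 2 * |u| ^ 2) := by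
  have himage : (fun u : ℝ => |u|) '' Set.Icc (-1) 1 = Set.Icc 0 1 := by
    ext x
    constructor
    · rintro ⟨u, hu, rfl⟩
      exact ⟨abs_nonneg u, abs_le.2 hu⟩
    · exact fun hx => ⟨x, ⟨by linarith [hx.1], hx.2⟩, abs_of_nonneg hx.1⟩
  have habs : ConvexOn ℝ (Set.Icc (-1) 1) (fun u : ℝ => |u|) :=
    convexOn_univ_norm.subset (Set.subset_univ _) (convex_Icc _ _)
  exact ConvexOn.comp (g := fun u : ℝ => u ^ p - p * (p - 1) / 2 * u ^ 2)
    (himage ▸ convexOn_rpow_sub_sq hp1 hp2) habs (himage ▸ monotoneOn_rpow_sub_sq hp1 hp2)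

/-- A quantitative midpoint convexity inequality for `|u| ^ p`, `1 < p ≤ 2`. -/
lemma abs_midpoint_rpow_add_le {p : ℝ} (hp1 : 1 < p) (hp2 : p ≤ 2) (a b : ℝ) :
    |(a + b) / 2| ^ p + p * (p - 1) / 8 * ((a - b) ^ 2 * (|a| + |b|) ^ (p - 2)) ≤
      (|a| ^ p + |b| ^ p) / 2 := by
  rcases (add_nonneg (abs_nonneg a) (abs_nonneg b)).eq_or_lt with h0 | hM
  · have ha : a = 0 := abs_eq_zero.1 (by linarith [abs_nonneg a, abs_nonneg b])
    have hb : b = 0 := abs_eq_zero.1 (by linarith [abs_nonneg a, abs_nonneg b])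
    simp [ha, hb, Real.zero_rpow (by linarith : p ≠ 0)]
  set M := |a| + |b| with hMdef
  have hmem : ∀ c : ℝ, |c| ≤ M → c / M ∈ Set.Icc (-1 : ℝ) 1 := fun c hc => by
    rw [Set.mem_Icc, ← abs_le, abs_div, abs_of_pos hM]
    exact (div_le_one hM).2 hc
  have h := (convexOn_abs_rpow_sub_sq hp1 hp2).2 (hmem a (by linarith [abs_nonneg b]))
    (hmem b (by linarith [abs_nonneg a])) (by norm_num : (0 : ℝ) ≤ 1 / 2)
    (by norm_num : (0 : ℝ) ≤ 1 / 2) (by norm_num)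
  simp only [smul_eq_mul] at h
  rw [show 1 / 2 * (a / M) + 1 / 2 * (b / M) = (a + b) / 2 / M by ring] at h
  obtain ⟨c, hc⟩ : ∃ c, (a + b) / 2 = c := ⟨_, rfl⟩
  rw [hc] at h ⊢
  simp only [sq_abs] at h
  simp only [abs_div, abs_of_pos hM, Real.div_rpow (abs_nonneg _) hM.le] at h
  have hMp : 0 < M ^ p := Real.rpow_pos_of_pos hM p
  rw [Real.rpow_sub hM, Real.rpow_two]
  have h' := mul_le_mul_of_nonneg_left h hMp.le
  generalize |c| ^ p = X at h' ⊢
  subst hc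
  field_simp at h' ⊢
  linarith

/-- A bounded sequence equal to its own contracted shift plus a square-summable
perturbation is square-summable. -/
lemma summable_sq_of_eq_add_mul_succ {lam B : ℝ} (h0 : 0 < lam) (h1 : lam < 1)
    {d η : ℕ → ℝ} (hd : Summable fun n => d n ^ 2) (hη : ∀ n, η n ^ 2 ≤ B)
    (hrec : ∀ n, η n = d n + lam * η (n + 1)) : Summable fun n => η n ^ 2 := by
  have hl : 0 < 1 - lam := sub_pos.2 h1
  have hstep : ∀ n, η n ^ 2 ≤ d n ^ 2 / (1 - lam) + lam * η (n + 1) ^ 2 := fun n => by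
    rw [hrec n, ← sub_nonneg]
    have : d n ^ 2 / (1 - lam) + lam * η (n + 1) ^ 2 - (d n + lam * η (n + 1)) ^ 2 =
        lam / (1 - lam) * (d n - (1 - lam) * η (n + 1)) ^ 2 := by
      field_simp
      ring
    rw [this]
    positivity
  refine summable_of_sum_range_le (c := ((∑' n, d n ^ 2) / (1 - lam) + lam * B) / (1 - lam))
    (fun n => sq_nonneg _) fun N => ?_
  rw [le_div_iff₀ hl]
  have hsum := Finset.sum_le_sum fun n (_ : n ∈ Finset.range N) => hstep n
  rw [Finset.sum_add_distrib, ← Finset.sum_div, ← Finset.mul_sum] at hsum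
  have hshift : ∑ n ∈ Finset.range N, η (n + 1) ^ 2 ≤ ∑ n ∈ Finset.range N, η n ^ 2 + B := by
    have := Finset.sum_range_succ' (fun n => η n ^ 2) N
    rw [Finset.sum_range_succ] at this
    linarith [hη N, sq_nonneg (η 0)]
  have hds : (∑ n ∈ Finset.range N, d n ^ 2) / (1 - lam) ≤ (∑' n, d n ^ 2) / (1 - lam) := by
    gcongr
    exact hd.sum_le_tsum _ fun n _ => sq_nonneg _
  linarith [mul_le_mul_of_nonneg_left hshift h0.le]

lemma summable_sq_tsum_geometric_mul {lam D : ℝ} (h0 : 0 < lam) (h1 : lam < 1)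
    {d : ℕ → ℝ} (hd0 : ∀ n, 0 ≤ d n) (hdD : ∀ n, d n ≤ D) (hd : Summable fun n => d n ^ 2) :
    Summable fun n => (∑' k, lam ^ k * d (n + k)) ^ 2 := by
  have hgeom : Summable fun k : ℕ => lam ^ k * D :=
    (summable_geometric_of_lt_one h0.le h1).mul_right D
  have hle : ∀ n k, lam ^ k * d (n + k) ≤ lam ^ k * D := fun n k =>
    mul_le_mul_of_nonneg_left (hdD _) (by positivity)
  have hnn : ∀ n k, 0 ≤ lam ^ k * d (n + k) := fun n k => mul_nonneg (by positivity) (hd0 _)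
  have hs : ∀ n, Summable fun k => lam ^ k * d (n + k) := fun n =>
    hgeom.of_nonneg_of_le (hnn n) (hle n)
  refine summable_sq_of_eq_add_mul_succ (B := (∑' k : ℕ, lam ^ k * D) ^ 2) h0 h1 hd
    (fun n => pow_le_pow_left₀ (tsum_nonneg (hnn n)) ((hs n).tsum_le_tsum (hle n) hgeom) 2)
    fun n => ?_
  rw [(hs n).tsum_eq_zero_add, ← tsum_mul_left]
  simp only [pow_zero, one_mul, add_zero]
  congr 1
  refine tsum_congr fun k => ?_
  rw [show n + (k + 1) = n + 1 + k by ring]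
  ring

section Lp

variable {Ω : Type*} {m : MeasurableSpace Ω} {μ : Measure Ω} {p : ℝ}

lemma integrable_abs_rpow_of_memLp (hp : 0 < p) {f : Ω → ℝ}
    (hf : MemLp f (ENNReal.ofReal p) μ) : Integrable (fun ω => |f ω| ^ p) μ := by
  have h := hf.integrable_norm_rpow (by simpa using hp) ENNReal.ofReal_ne_top
  simpa only [ENNReal.toReal_ofReal hp.le, Real.norm_eq_abs] using h

lemma toReal_eLpNorm_eq_integral_abs_rpow (hp : 0 < p) {f : Ω → ℝ}
    (hf : MemLp f (ENNReal.ofReal p) μ) :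
    (eLpNorm f (ENNReal.ofReal p) μ).toReal = (∫ ω, |f ω| ^ p ∂μ) ^ p⁻¹ := by
  rw [hf.eLpNorm_eq_integral_rpow_norm (by simpa using hp) ENNReal.ofReal_ne_top,
    ENNReal.toReal_ofReal (by positivity)]
  simp only [ENNReal.toReal_ofReal hp.le, Real.norm_eq_abs]

lemma integral_rpow_mul_rpow_le {f g : Ω → ℝ} (hf : Integrable f μ) (hg : Integrable g μ)
    (hf0 : ∀ ω, 0 ≤ f ω) (hg0 : ∀ ω, 0 ≤ g ω) {s t : ℝ} (hs : 0 ≤ s) (ht : 0 ≤ t)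
    (hst : s + t = 1) :
    ∫ ω, f ω ^ s * g ω ^ t ∂μ ≤ (∫ ω, f ω ∂μ) ^ s * (∫ ω, g ω ∂μ) ^ t := by
  have hF : 0 ≤ ∫ ω, f ω ∂μ := integral_nonneg hf0
  have hG : 0 ≤ ∫ ω, g ω ∂μ := integral_nonneg hg0
  have h := ENNReal.lintegral_mul_norm_pow_le (μ := μ) hf.1.aemeasurable.ennreal_ofReal
    hg.1.aemeasurable.ennreal_ofReal hs ht hst
  rw [← ofReal_integral_eq_lintegral_ofReal hf (.of_forall hf0),
    ← ofReal_integral_eq_lintegral_ofReal hg (.of_forall hg0),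
    ENNReal.ofReal_rpow_of_nonneg hF hs, ENNReal.ofReal_rpow_of_nonneg hG ht,
    ← ENNReal.ofReal_mul (by positivity)] at h
  have hmeas : AEStronglyMeasurable (fun ω => f ω ^ s * g ω ^ t) μ :=
    ((hf.1.aemeasurable.pow_const s).mul (hg.1.aemeasurable.pow_const t)).aestronglyMeasurable
  rw [integral_eq_lintegral_of_nonneg_ae
    (.of_forall fun ω => mul_nonneg (Real.rpow_nonneg (hf0 ω) s) (Real.rpow_nonneg (hg0 ω) t))
    hmeas]
  refine ENNReal.toReal_le_of_le_ofReal (by positivity) (le_trans (le_of_eq ?_) h)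
  refine lintegral_congr fun ω => ?_
  rw [ENNReal.ofReal_mul (Real.rpow_nonneg (hf0 ω) s), ENNReal.ofReal_rpow_of_nonneg (hf0 ω) hs,
    ENNReal.ofReal_rpow_of_nonneg (hg0 ω) ht]

lemma abs_sub_rpow_eq (a b : ℝ) (hp : 0 < p) :
    |a - b| ^ p =
      ((a - b) ^ 2 * (|a| + |b|) ^ (p - 2)) ^ (p / 2) * ((|a| + |b|) ^ p) ^ (1 - p / 2) := by
  rcases (add_nonneg (abs_nonneg a) (abs_nonneg b)).eq_or_lt with h0 | hM
  · have ha : a = 0 := abs_eq_zero.1 (by linarith [abs_nonneg a, abs_nonneg b])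
    have hb : b = 0 := abs_eq_zero.1 (by linarith [abs_nonneg a, abs_nonneg b])
    simp [ha, hb, Real.zero_rpow hp.ne', Real.zero_rpow (by positivity : p / 2 ≠ 0)]
  · rw [Real.mul_rpow (sq_nonneg _) (by positivity), ← sq_abs, ← Real.rpow_natCast,
      ← Real.rpow_mul (abs_nonneg _), ← Real.rpow_mul hM.le, ← Real.rpow_mul hM.le, mul_assoc,
      ← Real.rpow_add hM]
    rw [show (p - 2) * (p / 2) + p * (1 - p / 2) = 0 by ring, Real.rpow_zero, mul_one]
    congr 1
    push_cast
    ring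

lemma integrable_sq_mul_rpow (hp1 : 1 < p) (hp2 : p ≤ 2) {f g : Ω → ℝ}
    (hf : MemLp f (ENNReal.ofReal p) μ) (hg : MemLp g (ENNReal.ofReal p) μ) :
    Integrable (fun ω => (f ω - g ω) ^ 2 * (|f ω| + |g ω|) ^ (p - 2)) μ := by
  have hp : 0 < p := by linarith
  have hk : 0 < p * (p - 1) / 8 := div_pos (mul_pos hp (by linarith)) (by norm_num)
  have hfm := hf.1.aemeasurable
  have hgm := hg.1.aemeasurable
  refine (((integrable_abs_rpow_of_memLp hp hf).add
    (integrable_abs_rpow_of_memLp hp hg)).const_mul (p * (p - 1) / 8)⁻¹).mono'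
    (AEMeasurable.aestronglyMeasurable (by fun_prop)) (.of_forall fun ω => ?_)
  rw [Real.norm_of_nonneg (by positivity), le_inv_mul_iff₀ hk]
  have h := abs_midpoint_rpow_add_le hp1 hp2 (f ω) (g ω)
  have h1 : 0 ≤ |(f ω + g ω) / 2| ^ p := by positivity
  have h2 : 0 ≤ |f ω| ^ p := by positivity
  have h3 : 0 ≤ |g ω| ^ p := by positivity
  simp only [Pi.add_apply]
  linarith

lemma sq_toReal_eLpNorm_sub_le (hp1 : 1 < p) (hp2 : p ≤ 2) {f g : Ω → ℝ}
    (hf : MemLp f (ENNReal.ofReal p) μ) (hg : MemLp g (ENNReal.ofReal p) μ) :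
    (eLpNorm (fun ω => f ω - g ω) (ENNReal.ofReal p) μ).toReal ^ 2 ≤
      (∫ ω, (f ω - g ω) ^ 2 * (|f ω| + |g ω|) ^ (p - 2) ∂μ) *
        (∫ ω, (|f ω| + |g ω|) ^ p ∂μ) ^ ((2 - p) / p) := by
  have hp : 0 < p := by linarith
  have hsum : Integrable (fun ω => (|f ω| + |g ω|) ^ p) μ := by
    refine (integrable_abs_rpow_of_memLp hp (hf.abs.add hg.abs)).congr (.of_forall fun ω => ?_)
    simp only [Pi.add_apply, Pi.abs_apply]
    rw [abs_of_nonneg (by positivity)]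
  have hH := integral_rpow_mul_rpow_le (s := p / 2) (t := 1 - p / 2)
    (integrable_sq_mul_rpow hp1 hp2 hf hg) hsum (fun ω => by positivity) (fun ω => by positivity)
    (by linarith) (by linarith) (by ring)
  simp only [← abs_sub_rpow_eq _ _ hp] at hH
  have hW : 0 ≤ ∫ ω, (f ω - g ω) ^ 2 * (|f ω| + |g ω|) ^ (p - 2) ∂μ :=
    integral_nonneg fun ω => by positivity
  have hS : 0 ≤ ∫ ω, (|f ω| + |g ω|) ^ p ∂μ := integral_nonneg fun ω => by positivity
  have hI : 0 ≤ ∫ ω, |f ω - g ω| ^ p ∂μ := integral_nonneg fun ω => by positivity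
  rw [toReal_eLpNorm_eq_integral_abs_rpow (f := fun ω => f ω - g ω) hp (hf.sub hg),
    ← Real.rpow_natCast, ← Real.rpow_mul hI]
  refine (Real.rpow_le_rpow hI hH (by positivity)).trans (le_of_eq ?_)
  rw [Real.mul_rpow (by positivity) (by positivity), ← Real.rpow_mul hW, ← Real.rpow_mul hS]
  congr 1
  · rw [show p / 2 * (p⁻¹ * ((2 : ℕ) : ℝ)) = 1 by push_cast; field_simp, Real.rpow_one]
  · congr 1
    push_cast
    field_simp

lemma integral_abs_add_abs_rpow_le (hp1 : 1 ≤ p) {f g : Ω → ℝ}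
    (hf : MemLp f (ENNReal.ofReal p) μ) (hg : MemLp g (ENNReal.ofReal p) μ) :
    ∫ ω, (|f ω| + |g ω|) ^ p ∂μ ≤
      2 ^ (p - 1) * (∫ ω, |f ω| ^ p ∂μ + ∫ ω, |g ω| ^ p ∂μ) := by
  have hp : 0 < p := by linarith
  have hfi := integrable_abs_rpow_of_memLp hp hf
  have hgi := integrable_abs_rpow_of_memLp hp hg
  rw [← integral_add hfi hgi, ← integral_const_mul]
  refine integral_mono_of_nonneg (.of_forall fun ω => by positivity)
    ((hfi.add hgi).const_mul _) (.of_forall fun ω => ?_)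
  exact_mod_cast NNReal.rpow_add_le_mul_rpow_add_rpow ‖f ω‖₊ ‖g ω‖₊ hp1

/-- If `f` is the conditional expectation of `g`, the weighted square of `g - f` is controlled by
the increment of the `p`-th moments. -/
lemma integral_sq_mul_rpow_le [IsFiniteMeasure μ] (hp1 : 1 < p) (hp2 : p ≤ 2)
    {m' : MeasurableSpace Ω} (hm' : m' ≤ m) {f g : Ω → ℝ}
    (hf : MemLp f (ENNReal.ofReal p) μ) (hg : MemLp g (ENNReal.ofReal p) μ)
    (hfint : Integrable f μ) (hgint : Integrable g μ) (hfm : StronglyMeasurable[m'] f)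
    (hfg : μ[g | m'] =ᵐ[μ] f) :
    p * (p - 1) / 4 * ∫ ω, (g ω - f ω) ^ 2 * (|g ω| + |f ω|) ^ (p - 2) ∂μ ≤
      ∫ ω, |g ω| ^ p ∂μ - ∫ ω, |f ω| ^ p ∂μ := by
  have hp : 0 < p := by linarith
  have hfi := integrable_abs_rpow_of_memLp hp hf
  have hgi := integrable_abs_rpow_of_memLp hp hg
  have hmid : MemLp (fun ω => (g ω + f ω) / 2) (ENNReal.ofReal p) μ := by
    simpa only [div_eq_mul_inv, mul_comm, Pi.add_apply] using (hg.add hf).const_mul (2 : ℝ)⁻¹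
  have hmi := integrable_abs_rpow_of_memLp hp hmid
  have hcond : μ[fun ω => (g ω + f ω) / 2 | m'] =ᵐ[μ] f := by
    have h1 : (fun ω => (g ω + f ω) / 2) = (2 : ℝ)⁻¹ • (g + f) := by
      ext ω
      simp only [Pi.smul_apply, Pi.add_apply, smul_eq_mul]
      ring
    rw [h1]
    filter_upwards [condExp_smul (μ := μ) (2 : ℝ)⁻¹ (g + f) m', condExp_add hgint hfint m', hfg]
      with ω h2 h3 h4
    rw [h2, Pi.smul_apply, h3, Pi.add_apply, h4, condExp_of_stronglyMeasurable hm' hfm hfint,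
      smul_eq_mul]
    ring
  have hjensen : ∫ ω, |f ω| ^ p ∂μ ≤ ∫ ω, |(g ω + f ω) / 2| ^ p ∂μ := by
    rw [← integral_condExp hm' (f := fun ω => |(g ω + f ω) / 2| ^ p)]
    refine integral_mono_ae hfi integrable_condExp ?_
    filter_upwards [Integrable.norm_condExp_rpow_le (m := m') hp1.le
      (f := fun ω => (g ω + f ω) / 2) hmi, hcond] with ω h1 h2
    rw [h2] at h1
    exact h1
  have hw := integrable_sq_mul_rpow hp1 hp2 hg hf
  have h := integral_mono (hmi.add (hw.const_mul (p * (p - 1) / 8)))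
    ((hgi.add hfi).div_const 2) fun ω => abs_midpoint_rpow_add_le hp1 hp2 (g ω) (f ω)
  simp only [Pi.add_apply] at h
  rw [integral_add hmi (hw.const_mul _), integral_const_mul, integral_div,
    integral_add hgi hfi] at h
  linarith

/-- The squared `L^p`-norms of the differences of an `L^p`-bounded martingale are summable
for `1 < p ≤ 2`. -/
lemma summable_sq_eLpNorm_martingale_sub [IsFiniteMeasure μ] (hp1 : 1 < p) (hp2 : p ≤ 2)
    {ℱ : Filtration ℕ m} {Φ : ℕ → Ω → ℝ} (hmart : Martingale Φ ℱ μ)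
    (hmem : ∀ n, MemLp (Φ n) (ENNReal.ofReal p) μ) {B : ℝ}
    (hB : ∀ n, ∫ ω, |Φ n ω| ^ p ∂μ ≤ B) :
    Summable fun n =>
      (eLpNorm (fun ω => Φ (n + 1) ω - Φ n ω) (ENNReal.ofReal p) μ).toReal ^ 2 := by
  have hp : 0 < p := by linarith
  have hk : 0 < p * (p - 1) / 4 := div_pos (mul_pos hp (by linarith)) (by norm_num)
  have hN0 : ∀ n, 0 ≤ ∫ ω, |Φ n ω| ^ p ∂μ := fun n => integral_nonneg fun ω => by positivity
  have hB0 : 0 ≤ B := (hN0 0).trans (hB 0)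
  set K : ℝ := (2 ^ (p - 1) * (B + B)) ^ ((2 - p) / p)
  have hK0 : 0 ≤ K := by positivity
  have hexp : 0 ≤ (2 - p) / p := div_nonneg (by linarith) hp.le
  have hstep : ∀ n,
      (eLpNorm (fun ω => Φ (n + 1) ω - Φ n ω) (ENNReal.ofReal p) μ).toReal ^ 2 ≤
        K * (p * (p - 1) / 4)⁻¹ * (∫ ω, |Φ (n + 1) ω| ^ p ∂μ - ∫ ω, |Φ n ω| ^ p ∂μ) := by
    intro n
    have h1 := sq_toReal_eLpNorm_sub_le hp1 hp2 (hmem (n + 1)) (hmem n)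
    have h2 := integral_sq_mul_rpow_le hp1 hp2 (ℱ.le n) (hmem n) (hmem (n + 1))
      (hmart.integrable n) (hmart.integrable (n + 1)) (hmart.stronglyMeasurable n)
      (hmart.condExp_ae_eq n.le_succ)
    rw [← le_inv_mul_iff₀ hk] at h2
    have h3 : (∫ ω, (|Φ (n + 1) ω| + |Φ n ω|) ^ p ∂μ) ^ ((2 - p) / p) ≤ K := by
      refine Real.rpow_le_rpow (integral_nonneg fun ω => by positivity) ?_ hexp
      refine (integral_abs_add_abs_rpow_le hp1.le (hmem (n + 1)) (hmem n)).trans ?_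
      gcongr
      exacts [hB _, hB _]
    calc _ ≤ _ := h1
      _ ≤ (∫ ω, (Φ (n + 1) ω - Φ n ω) ^ 2 * (|Φ (n + 1) ω| + |Φ n ω|) ^ (p - 2) ∂μ) * K :=
        mul_le_mul_of_nonneg_left h3 (integral_nonneg fun ω => by positivity)
      _ ≤ _ := by
        rw [mul_comm _ K, mul_assoc]
        exact mul_le_mul_of_nonneg_left h2 hK0
  refine summable_of_sum_range_le (c := K * (p * (p - 1) / 4)⁻¹ * B) (fun n => sq_nonneg _)
    fun N => (Finset.sum_le_sum fun n _ => hstep n).trans ?_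
  rw [← Finset.mul_sum, Finset.sum_range_sub (fun n => ∫ ω, |Φ n ω| ^ p ∂μ)]
  gcongr
  linarith [hB N, hN0 0]

end Lp

/-- If `(Φₙ)` is an `L^p`-bounded martingale on a probability space,
`1 < p ≤ 2`, and `ηₙ = ∑_{m≥n} λ^(m-n) ‖hₘ‖_p` is the geometrically weighted tail sum of
the `L^p`-norms of the martingale differences `hₘ = Φₘ - Φₘ₋₁`, then `∑ ηₙ² < ∞`. -/
theorem weighted_tail_martingale_differences_l2
    {Ω : Type*} {m : MeasurableSpace Ω} (μ : Measure Ω) [IsProbabilityMeasure μ]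
    (ℱ : Filtration ℕ m)
    (p : ℝ) (hp1 : 1 < p) (hp2 : p ≤ 2)
    (Φ : ℕ → Ω → ℝ) (hmart : Martingale Φ ℱ μ)
    (C : ℝ)
    (hbdd : ∀ n, eLpNorm (Φ n) (ENNReal.ofReal p) μ ≤ ENNReal.ofReal C)
    (lam : ℝ) (hlam0 : 0 < lam) (hlam1 : lam < 1)
    (η : ℕ → ℝ)
    (hη : ∀ n, η n = ∑' k : ℕ,
      lam ^ k *
        (eLpNorm (fun ω => Φ (n + k + 1) ω - Φ (n + k) ω) (ENNReal.ofReal p) μ).toReal) :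
    Summable (fun n => (η n) ^ 2) := by
  have hp : 0 < p := by linarith
  have hmem : ∀ n, MemLp (Φ n) (ENNReal.ofReal p) μ := fun n =>
    ⟨(hmart.integrable n).1, (hbdd n).trans_lt ENNReal.ofReal_lt_top⟩
  have hB : ∀ n, ∫ ω, |Φ n ω| ^ p ∂μ ≤ (max C 0) ^ p := fun n => by
    have h := ENNReal.toReal_mono ENNReal.ofReal_ne_top (hbdd n)
    rw [toReal_eLpNorm_eq_integral_abs_rpow hp (hmem n), ENNReal.toReal_ofReal'] at h
    exact (Real.rpow_inv_le_iff_of_pos (integral_nonneg fun ω => by positivity)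
      (le_max_right _ _) hp).1 h
  have hle : ∀ n, (eLpNorm (fun ω => Φ (n + 1) ω - Φ n ω) (ENNReal.ofReal p) μ).toReal ≤
      (ENNReal.ofReal C + ENNReal.ofReal C).toReal := fun n =>
    ENNReal.toReal_mono (by simp) <|
      (eLpNorm_sub_le (hmem (n + 1)).1 (hmem n).1
        (by simpa using hp1.le)).trans (add_le_add (hbdd _) (hbdd _))
  have h := summable_sq_tsum_geometric_mul hlam0 hlam1 (fun n => ENNReal.toReal_nonneg) hle
    (summable_sq_eLpNorm_martingale_sub hp1 hp2 hmart hmem hB)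
  simpa only [← hη] using h
end

section
/- Let I = [0,1), let f : I \to I be a map and D : I \to (0,\infty) a function such that the total variation of t \mapsto \log D(t) over I is at most \theta \ge 0. Let x, y \in I and q \ge 1 be such that the q closed intervals J_s with endpoints f^s(x) and f^s(y), for s = 0, 1, \dots, q-1, are pairwise disjoint. Then for every l with 0 \le l \le q-1, e^{-\theta} \le \left( \prod_{s=0}^{l-1} D(f^s(x)) \right) / \left( \prod_{s=0}^{l-1} D(f^s(y)) \right) \le e^{\theta}. -/
open Set

/-- If the intervals with endpoints `a i` and `b i` are pairwise disjoint, the sum of the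
oscillations of `g` between these endpoints is at most the variation of `g` on the set of all
the endpoints. -/
theorem sum_edist_le_eVariationOn_biUnion {ι α E : Type*} [LinearOrder α] [PseudoEMetricSpace E]
    (g : α → E) (a b : ι → α) (A : Finset ι)
    (hdisj : (A : Set ι).Pairwise fun i j => Disjoint (uIcc (a i) (b i)) (uIcc (a j) (b j))) :
    ∑ i ∈ A, edist (g (a i)) (g (b i)) ≤ eVariationOn g (⋃ i ∈ A, {a i, b i}) := by
  classical
  induction A using Finset.induction_on_max_value (fun i => a i ⊔ b i) with
  | empty => simp
  | insert i A hi hmax ih =>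
    rw [Finset.coe_insert] at hdisj
    have hsep : ∀ j ∈ A, a j ⊔ b j < a i ⊓ b i := by
      intro j hj
      by_contra! h
      have hij : i ≠ j := fun e => hi (e ▸ hj)
      exact Set.disjoint_left.1 (hdisj (mem_insert _ _) (mem_insert_of_mem _ hj) hij)
        ⟨h, hmax j hj⟩ ⟨inf_le_sup, le_rfl⟩
    rw [Finset.sum_insert hi, Finset.set_biUnion_insert, union_comm, add_comm,
      ← eVariationOn.pair g (a i) (b i)]
    refine (add_le_add_left (ih (hdisj.mono (subset_insert _ _))) _).trans
      (eVariationOn.add_le_union g ?_)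
    intro u hu v hv
    simp only [mem_iUnion, exists_prop] at hu
    obtain ⟨j, hj, hu⟩ := hu
    have hu' : u ≤ a j ⊔ b j := by rcases hu with rfl | rfl <;> simp
    have hv' : a i ⊓ b i ≤ v := by rcases hv with rfl | rfl <;> simp
    exact hu'.trans ((hsep j hj).le.trans hv')

/-- If the intervals with endpoints `a i` and `b i` are pairwise disjoint and all these endpoints
lie in `s`, the increments of `g` along these intervals add up to at most the variation of `g`
on `s`. -/
theorem abs_sum_sub_le_of_eVariationOn_le {ι α : Type*} [LinearOrder α] {g : α → ℝ} {s : Set α}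
    {θ : ℝ} (hθ : 0 ≤ θ) (hvar : eVariationOn g s ≤ ENNReal.ofReal θ) {a b : ι → α} {A : Finset ι}
    (ha : ∀ i ∈ A, a i ∈ s) (hb : ∀ i ∈ A, b i ∈ s)
    (hdisj : (A : Set ι).Pairwise fun i j => Disjoint (uIcc (a i) (b i)) (uIcc (a j) (b j))) :
    |∑ i ∈ A, (g (a i) - g (b i))| ≤ θ := by
  refine (Finset.abs_sum_le_sum_abs _ _).trans ?_
  rw [← ENNReal.ofReal_le_ofReal_iff hθ, ENNReal.ofReal_sum_of_nonneg fun _ _ => abs_nonneg _]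
  simp only [← Real.dist_eq, ← edist_dist]
  refine (sum_edist_le_eVariationOn_biUnion g a b A hdisj).trans
    ((eVariationOn.mono g ?_).trans hvar)
  exact iUnion₂_subset fun i hi => pair_subset (ha i hi) (hb i hi)

/-- If `f : I → I` (with `I = [0,1)`), `D : I → (0,∞)` has
`log D` of total variation at most `θ` on `I`, and the intervals with endpoints
`f^s(x)`, `f^s(y)` for `s = 0, …, q-1` are pairwise disjoint, then for all `0 ≤ l ≤ q-1`
the ratio `∏_{s<l} D(f^s(x)) / ∏_{s<l} D(f^s(y))` lies in `[e^{-θ}, e^{θ}]`. -/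
theorem ratio_of_derivative_products_bounded
    (f : ℝ → ℝ) (hf : MapsTo f (Ico (0:ℝ) 1) (Ico (0:ℝ) 1))
    (D : ℝ → ℝ) (hD : ∀ t ∈ Ico (0:ℝ) 1, 0 < D t)
    (θ : ℝ) (hθ : 0 ≤ θ)
    (hvar : eVariationOn (fun t => Real.log (D t)) (Ico (0:ℝ) 1) ≤ ENNReal.ofReal θ)
    (x y : ℝ) (hx : x ∈ Ico (0:ℝ) 1) (hy : y ∈ Ico (0:ℝ) 1)
    (q : ℕ) (hq : 1 ≤ q)
    (hdisj : ∀ s < q, ∀ t < q, s ≠ t →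
      Disjoint (uIcc (f^[s] x) (f^[s] y)) (uIcc (f^[t] x) (f^[t] y)))
    (l : ℕ) (hl : l < q) :
    Real.exp (-θ) ≤
        (∏ s ∈ Finset.range l, D (f^[s] x)) / (∏ s ∈ Finset.range l, D (f^[s] y)) ∧
      (∏ s ∈ Finset.range l, D (f^[s] x)) / (∏ s ∈ Finset.range l, D (f^[s] y)) ≤
        Real.exp θ := by
  have hxs : ∀ s, f^[s] x ∈ Ico (0:ℝ) 1 := fun s => hf.iterate s hx
  have hys : ∀ s, f^[s] y ∈ Ico (0:ℝ) 1 := fun s => hf.iterate s hy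
  have hPx := Finset.prod_pos fun s (_ : s ∈ Finset.range l) => hD _ (hxs s)
  have hPy := Finset.prod_pos fun s (_ : s ∈ Finset.range l) => hD _ (hys s)
  have hbound := abs_sum_sub_le_of_eVariationOn_le (A := Finset.range l) hθ hvar
    (fun s _ => hxs s) (fun s _ => hys s) fun s hs t ht hst =>
      hdisj s ((Finset.mem_range.1 hs).trans hl) t ((Finset.mem_range.1 ht).trans hl) hst
  rw [Finset.sum_sub_distrib, ← Real.log_prod fun s _ => (hD _ (hxs s)).ne',
    ← Real.log_prod fun s _ => (hD _ (hys s)).ne', ← Real.log_div hPx.ne' hPy.ne',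
    abs_le] at hbound
  have hpos := div_pos hPx hPy
  exact ⟨(Real.le_log_iff_exp_le hpos).1 hbound.1, (Real.log_le_iff_le_exp hpos).1 hbound.2⟩
end

section
/- Let I = [0,1), let f : I \to I be a map, [a,b] \subset I a nondegenerate closed interval, q \ge 1, and D : I \to (0,\infty) a function whose total variation of \log D over I is at most \theta \ge 0. Assume that for each s = 0, \dots, q-1 the map f is differentiable at every point of the interval f^s([a,b]) with derivative equal to D there (so each f^s restricted to [a,b] is an increasing diffeomorphism onto the interval f^s([a,b])), and that the intervals f^s([a,b]), s = 0, \dots, q-1, are pairwise disjoint. For x \in (a,b) and 0 \le i \le q-1 define the relative coordinates z_i = (f^i(x) - f^i(a)) / (f^i(b) - f^i(a)). Then e^{-2\theta} \le \frac{z_0 (1 - z_0)}{z_i (1 - z_i)} \le e^{2\theta}. -/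
open Set

/-- The variations over finitely many pairwise disjoint nonempty intervals add up to at most the
variation over their union. -/
theorem eVariationOn_sum_le_biUnion {ι α E : Type*} [LinearOrder α] [PseudoEMetricSpace E]
    (φ : α → E) (F : Finset ι) (J : ι → Set α) (u : ι → α) (hu : ∀ s ∈ F, u s ∈ J s)
    (hJ : ∀ s ∈ F, (J s).OrdConnected)
    (hdisj : ∀ s ∈ F, ∀ t ∈ F, s ≠ t → Disjoint (J s) (J t)) :
    ∑ s ∈ F, eVariationOn φ (J s) ≤ eVariationOn φ (⋃ s ∈ F, J s) := by
  classical
  induction F using Finset.induction_on_max_value u with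
  | empty => simp
  | insert m F hm hmax ih =>
    rw [Finset.sum_insert hm, Finset.set_biUnion_insert, add_comm, union_comm]
    refine (add_le_add_left (ih ?_ ?_ ?_) _).trans (eVariationOn.add_le_union φ ?_)
    · exact fun s hs => hu s (Finset.mem_insert_of_mem hs)
    · exact fun s hs => hJ s (Finset.mem_insert_of_mem hs)
    · exact fun s hs t ht => hdisj s (Finset.mem_insert_of_mem hs) t (Finset.mem_insert_of_mem ht)
    · intro y hy z hz
      simp only [mem_iUnion, exists_prop] at hy
      obtain ⟨s, hs, hy⟩ := hy
      have hsF := Finset.mem_insert_of_mem (a := s) (b := m) hs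
      have hmF := Finset.mem_insert_self m F
      have hd := disjoint_left.1 (hdisj s hsF m hmF (by rintro rfl; exact hm hs))
      by_contra! hzy
      rcases le_total z (u s) with h | h
      · exact hd (hu s hsF) ((hJ m hmF).out hz (hu m hmF) ⟨h, hmax s hs⟩)
      · exact hd ((hJ s hsF).out (hu s hsF) hy ⟨h, hzy.le⟩) hz

/-- A function of bounded variation has total oscillation over pairwise disjoint intervals at most
its variation. -/
theorem sum_abs_sub_le_of_eVariationOn_le {ι : Type*} {φ : ℝ → ℝ} {S : Set ℝ} {θ : ℝ}
    (hθ : 0 ≤ θ) (hvar : eVariationOn φ S ≤ ENNReal.ofReal θ) (F : Finset ι) (J : ι → Set ℝ)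
    (u v : ι → ℝ) (hu : ∀ s ∈ F, u s ∈ J s) (hv : ∀ s ∈ F, v s ∈ J s)
    (hJ : ∀ s ∈ F, (J s).OrdConnected) (hJS : ∀ s ∈ F, J s ⊆ S)
    (hdisj : ∀ s ∈ F, ∀ t ∈ F, s ≠ t → Disjoint (J s) (J t)) :
    ∑ s ∈ F, |φ (u s) - φ (v s)| ≤ θ := by
  rw [← ENNReal.ofReal_le_ofReal_iff hθ, ENNReal.ofReal_sum_of_nonneg fun _ _ => abs_nonneg _]
  calc ∑ s ∈ F, ENNReal.ofReal |φ (u s) - φ (v s)|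
      ≤ ∑ s ∈ F, eVariationOn φ (J s) := Finset.sum_le_sum fun s hs => by
        rw [← Real.dist_eq, ← edist_dist]
        exact eVariationOn.edist_le φ (hu s hs) (hv s hs)
    _ ≤ eVariationOn φ (⋃ s ∈ F, J s) := eVariationOn_sum_le_biUnion φ F J u hu hJ hdisj
    _ ≤ eVariationOn φ S := eVariationOn.mono φ (iUnion₂_subset hJS)
    _ ≤ ENNReal.ofReal θ := hvar

/-- The chain rule along an orbit. -/
theorem hasDerivAt_iterate_prod {f D : ℝ → ℝ} {t : ℝ} (n : ℕ)
    (h : ∀ s < n, HasDerivAt f (D (f^[s] t)) (f^[s] t)) :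
    HasDerivAt f^[n] (∏ s ∈ Finset.range n, D (f^[s] t)) t := by
  induction n with
  | zero => simpa using hasDerivAt_id t
  | succ n ih =>
    rw [Finset.prod_range_succ, mul_comm, Function.iterate_succ']
    exact (h n n.lt_succ_self).comp t (ih fun s hs => h s (hs.trans n.lt_succ_self))

/-- If the derivative of `g` on `[a, b]` is positive and has distortion at most `C`, then `g`
distorts the product `z (1 - z)` of relative coordinates by at most `C ^ 2`. -/
theorem relative_coordinate_mul_bounds_of_distortion {g g' : ℝ → ℝ} {a b x C : ℝ}
    (hC : 0 < C) (hx : x ∈ Ioo a b) (hg : ∀ t ∈ Icc a b, HasDerivAt g (g' t) t)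
    (hpos : ∀ t ∈ Icc a b, 0 < g' t)
    (hdist : ∀ s ∈ Icc a b, ∀ t ∈ Icc a b, g' s ≤ C * g' t) :
    (C ^ 2)⁻¹ ≤ ((x - a) / (b - a) * (1 - (x - a) / (b - a))) /
        ((g x - g a) / (g b - g a) * (1 - (g x - g a) / (g b - g a))) ∧
      ((x - a) / (b - a) * (1 - (x - a) / (b - a))) /
        ((g x - g a) / (g b - g a) * (1 - (g x - g a) / (g b - g a))) ≤ C ^ 2 := by
  obtain ⟨hax, hxb⟩ := hx
  have hab := hax.trans hxb
  have mvt : ∀ c d, a ≤ c → c < d → d ≤ b → ∃ ξ ∈ Icc a b, g d - g c = g' ξ * (d - c) := by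
    intro c d hac hcd hdb
    have hsub : Icc c d ⊆ Icc a b := Icc_subset_Icc hac hdb
    obtain ⟨ξ, hξ, h⟩ := exists_hasDerivAt_eq_slope g g' hcd
      (fun t ht => (hg t (hsub ht)).continuousAt.continuousWithinAt)
      (fun t ht => hg t (hsub (Ioo_subset_Icc_self ht)))
    refine ⟨ξ, hsub (Ioo_subset_Icc_self hξ), ?_⟩
    rw [h, div_mul_cancel₀ _ (sub_pos.2 hcd).ne']
  obtain ⟨ξ, hξ, h₁⟩ := mvt a x le_rfl hax hxb.le
  obtain ⟨η, hη, h₂⟩ := mvt x b hax.le hxb le_rfl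
  obtain ⟨ζ, hζ, h₃⟩ := mvt a b le_rfl hab le_rfl
  have p₁ := hpos ξ hξ
  have p₂ := hpos η hη
  have p₃ := hpos ζ hζ
  have d₁ : 0 < x - a := sub_pos.2 hax
  have d₂ : 0 < b - x := sub_pos.2 hxb
  have d₃ : 0 < b - a := sub_pos.2 hab
  have e₀ : 1 - (x - a) / (b - a) = (b - x) / (b - a) := by field_simp; ring
  have e₁ : 1 - (g x - g a) / (g b - g a) = (g b - g x) / (g b - g a) := by
    have : g b - g a ≠ 0 := by rw [h₃]; positivity
    field_simp; ring
  have key : ((x - a) / (b - a) * ((b - x) / (b - a))) /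
      ((g x - g a) / (g b - g a) * ((g b - g x) / (g b - g a))) =
      g' ζ ^ 2 / (g' ξ * g' η) := by
    rw [h₁, h₂, h₃]
    field_simp
  rw [e₀, e₁, key]
  constructor
  · rw [inv_le_iff_one_le_mul₀ (by positivity), div_mul_eq_mul_div, one_le_div (by positivity)]
    calc g' ξ * g' η ≤ (C * g' ζ) * (C * g' ζ) :=
          mul_le_mul (hdist ξ hξ ζ hζ) (hdist η hη ζ hζ) p₂.le (by positivity)
      _ = g' ζ ^ 2 * C ^ 2 := by ring
  · rw [div_le_iff₀ (by positivity)]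
    calc g' ζ ^ 2 = g' ζ * g' ζ := sq _
      _ ≤ (C * g' ξ) * (C * g' η) :=
          mul_le_mul (hdist ζ hζ ξ hξ) (hdist ζ hζ η hη) p₃.le (by positivity)
      _ = C ^ 2 * (g' ξ * g' η) := by ring

/-- Under disjointness of the iterates `f^s([a,b])`, `s < q`, and a bound
`θ` on the variation of `log D` (where `D = f'` on the iterated intervals), the relative
coordinates `z_i = (f^i(x) - f^i(a))/(f^i(b) - f^i(a))` satisfy
`e^{-2θ} ≤ z₀(1-z₀)/(z_i(1-z_i)) ≤ e^{2θ}`. -/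
theorem relative_coordinates_comparable
    (f : ℝ → ℝ) (hf : MapsTo f (Ico (0:ℝ) 1) (Ico (0:ℝ) 1))
    (a b : ℝ) (hab : a < b) (hsub : Icc a b ⊆ Ico (0:ℝ) 1)
    (q : ℕ) (hq : 1 ≤ q)
    (D : ℝ → ℝ) (hD : ∀ t ∈ Ico (0:ℝ) 1, 0 < D t)
    (θ : ℝ) (hθ : 0 ≤ θ)
    (hvar : eVariationOn (fun t => Real.log (D t)) (Ico (0:ℝ) 1) ≤ ENNReal.ofReal θ)
    (hderiv : ∀ s < q, ∀ t ∈ f^[s] '' Icc a b, HasDerivAt f (D t) t)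
    (hdisj : ∀ s < q, ∀ t < q, s ≠ t →
      Disjoint (f^[s] '' Icc a b) (f^[t] '' Icc a b))
    (x : ℝ) (hx : x ∈ Ioo a b) (i : ℕ) (hi : i < q) :
    ∀ z0 zi : ℝ,
      z0 = (x - a) / (b - a) →
      zi = (f^[i] x - f^[i] a) / (f^[i] b - f^[i] a) →
      Real.exp (-(2 * θ)) ≤ (z0 * (1 - z0)) / (zi * (1 - zi)) ∧
        (z0 * (1 - z0)) / (zi * (1 - zi)) ≤ Real.exp (2 * θ) := by
  rintro _ _ rfl rfl
  have horbit : ∀ s, ∀ t ∈ Icc a b, f^[s] t ∈ Ico (0:ℝ) 1 := fun s t ht =>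
    hf.iterate s (hsub ht)
  have hDpos : ∀ s, ∀ t ∈ Icc a b, 0 < D (f^[s] t) := fun s t ht => hD _ (horbit s t ht)
  have hiter : ∀ n < q, ∀ t ∈ Icc a b,
      HasDerivAt f^[n] (∏ s ∈ Finset.range n, D (f^[s] t)) t := fun n hn t ht =>
    hasDerivAt_iterate_prod n fun s hs => hderiv s (hs.trans hn) _ (mem_image_of_mem _ ht)
  have hprod : ∀ t ∈ Icc a b, 0 < ∏ s ∈ Finset.range i, D (f^[s] t) := fun t ht =>
    Finset.prod_pos fun s _ => hDpos s t ht
  have hlt : ∀ s ∈ Finset.range i, s < q := fun s hs => (Finset.mem_range.1 hs).trans hi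
  have hdist : ∀ t ∈ Icc a b, ∀ t' ∈ Icc a b, ∏ s ∈ Finset.range i, D (f^[s] t) ≤
      Real.exp θ * ∏ s ∈ Finset.range i, D (f^[s] t') := by
    intro t ht t' ht'
    have hsum := sum_abs_sub_le_of_eVariationOn_le hθ hvar (Finset.range i)
      (fun s => f^[s] '' Icc a b) (fun s => f^[s] t) (fun s => f^[s] t')
      (fun s _ => mem_image_of_mem _ ht) (fun s _ => mem_image_of_mem _ ht')
      (fun s hs => (isPreconnected_Icc.image _ fun y hy =>
        (hiter s (hlt s hs) y hy).continuousAt.continuousWithinAt).ordConnected)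
      (fun s _ => image_subset_iff.2 fun y hy => horbit s y hy)
      (fun s hs r hr => hdisj s (hlt s hs) r (hlt r hr))
    have hle := (Finset.sum_le_sum fun s _ => le_abs_self _).trans hsum
    rw [← Real.log_le_log_iff (hprod t ht) (mul_pos (Real.exp_pos θ) (hprod t' ht')),
      Real.log_mul (Real.exp_pos θ).ne' (hprod t' ht').ne', Real.log_exp,
      Real.log_prod fun s _ => (hDpos s t ht).ne', Real.log_prod fun s _ => (hDpos s t' ht').ne']
    rw [Finset.sum_sub_distrib] at hle
    linarith
  have hexp : Real.exp (2 * θ) = Real.exp θ ^ 2 := by rw [two_mul, Real.exp_add, sq]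
  rw [Real.exp_neg, hexp]
  exact relative_coordinate_mul_bounds_of_distortion (Real.exp_pos θ) hx (hiter i hi) hprod hdist
end

section
/- Let I = [0,1), let f : I \to I be a map, [a,b] \subset I a nondegenerate closed interval, q \ge 1, and D : I \to (0,\infty) a function whose total variation of \log D over I is at most \theta \ge 0. Assume that for each s = 0, \dots, q-1 the map f is differentiable on the interval f^s([a,b]) with derivative D there, that D is absolutely continuous on each f^s([a,b]) with almost-everywhere derivative D' integrable on I, and that the intervals f^s([a,b]), s = 0, \dots, q-1, are pairwise disjoint. For 0 \le i \le q-1 let \varphi_i : [0,1] \to [0,1] be the relative coordinate map \varphi_i(z_0) = (f^i(a + z_0(b-a)) - f^i(a)) / (f^i(b) - f^i(a)). Then there is a constant C depending only on \theta (and not on f, [a,b], q or i) such that \varphi_i has an absolutely continuous first derivative and \int_0^1 |\varphi_i''(z_0)|\, dz_0 \le C \int_I \left| \frac{D'(t)}{D(t)} \right| dt. -/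
open Set intervalIntegral
open MeasureTheory

/-- `F'` is integrable on `[a, b]` and `F` is a primitive of `F'` there. -/
def IsLebesguePrimitiveOn (F F' : ℝ → ℝ) (a b : ℝ) : Prop :=
  IntegrableOn F' (Icc a b) ∧
    ∀ u ∈ Icc a b, ∀ v ∈ Icc a b, F v - F u = ∫ t in u..v, F' t

namespace IsLebesguePrimitiveOn

variable {F F' G G' : ℝ → ℝ} {a b : ℝ}

theorem intervalIntegrable (hF : IsLebesguePrimitiveOn F F' a b) {u v : ℝ} (hu : u ∈ Icc a b)
    (hv : v ∈ Icc a b) : IntervalIntegrable F' volume u v :=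
  (hF.1.mono_set (uIcc_subset_Icc hu hv)).intervalIntegrable

theorem exists_absolutelyContinuous (hF : IsLebesguePrimitiveOn F F' a b) {u v : ℝ}
    (hu : u ∈ Icc a b) (hv : v ∈ Icc a b) :
    ∃ H : ℝ → ℝ, AbsolutelyContinuousOnInterval H u v ∧ (∀ x ∈ uIcc u v, H x = F x) ∧
      ∀ᵐ x, x ∈ uIcc u v → deriv H x = F' x := by
  have hintg := hF.intervalIntegrable hu hv
  refine ⟨fun x => F u + ∫ t in u..x, F' t, ?_, fun x hx => ?_, ?_⟩
  · exact (contDiff_const (c := F u)).contDiffOn.absolutelyContinuousOnInterval.add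
      (hintg.absolutelyContinuousOnInterval_intervalIntegral left_mem_uIcc)
  · have := hF.2 u hu x (uIcc_subset_Icc hu hv hx)
    simp only
    linarith
  · filter_upwards [hintg.ae_hasDerivAt_integral] with x hx hxm
    exact ((hx hxm u left_mem_uIcc).const_add (F u)).deriv

theorem continuousOn (hF : IsLebesguePrimitiveOn F F' a b) : ContinuousOn F (Icc a b) := by
  rcases le_or_gt a b with hab | hab
  · obtain ⟨H, hH, hHF, -⟩ :=
      hF.exists_absolutelyContinuous (left_mem_Icc.2 hab) (right_mem_Icc.2 hab)
    rw [← uIcc_of_le hab]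
    exact hH.continuousOn.congr fun x hx => (hHF x hx).symm
  · simp [Icc_eq_empty_of_lt hab]

/-- Product rule for absolutely continuous functions. -/
theorem mul (hF : IsLebesguePrimitiveOn F F' a b) (hG : IsLebesguePrimitiveOn G G' a b) :
    IsLebesguePrimitiveOn (fun x => F x * G x) (fun x => F' x * G x + F x * G' x) a b := by
  refine ⟨(hF.1.mul_continuousOn hG.continuousOn isCompact_Icc).add
    (hG.1.continuousOn_mul hF.continuousOn isCompact_Icc), fun u hu v hv => ?_⟩
  obtain ⟨H, hH, hHF, hH'⟩ := hF.exists_absolutelyContinuous hu hv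
  obtain ⟨K, hK, hKG, hK'⟩ := hG.exists_absolutelyContinuous hu hv
  have key := hH.integral_deriv_mul_eq_sub hK
  rw [hHF u left_mem_uIcc, hHF v right_mem_uIcc, hKG u left_mem_uIcc,
    hKG v right_mem_uIcc] at key
  rw [← key]
  refine intervalIntegral.integral_congr_ae ?_
  filter_upwards [hH', hK'] with x hx hx' hxm
  have hxm := uIoc_subset_uIcc hxm
  rw [hx hxm, hx' hxm, hHF x hxm, hKG x hxm]

/-- Composition with an increasing differentiable function. -/
theorem comp_strictMonoOn (hG : ∀ x ∈ Icc a b, HasDerivAt G (G' x) x)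
    (hpos : ∀ x ∈ Icc a b, 0 < G' x) (hmono : StrictMonoOn G (Icc a b))
    (hintg : IntegrableOn F' (G '' Icc a b))
    (hF : ∀ u ∈ G '' Icc a b, ∀ v ∈ G '' Icc a b, F v - F u = ∫ t in u..v, F' t) :
    IsLebesguePrimitiveOn (fun x => F (G x)) (fun x => F' (G x) * G' x) a b := by
  have habs : ∀ x ∈ Icc a b, |G' x| • F' (G x) = F' (G x) * G' x := fun x hx => by
    rw [abs_of_pos (hpos x hx), smul_eq_mul, mul_comm]
  refine ⟨?_, ?_⟩
  · rw [integrableOn_image_iff_integrableOn_abs_deriv_smul measurableSet_Icc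
      (fun x hx => (hG x hx).hasDerivWithinAt) hmono.injOn] at hintg
    exact hintg.congr_fun habs measurableSet_Icc
  · have key : ∀ u ∈ Icc a b, ∀ v ∈ Icc a b, u ≤ v →
        F (G v) - F (G u) = ∫ t in u..v, F' (G t) * G' t := by
      intro u hu v hv huv
      have hsub : Icc u v ⊆ Icc a b := Icc_subset_Icc hu.1 hv.2
      have himg : G '' Icc u v = Icc (G u) (G v) :=
        ContinuousOn.image_Icc_of_monotoneOn huv
          (fun x hx => (hG x (hsub hx)).continuousAt.continuousWithinAt)
          (hmono.monotoneOn.mono hsub)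
      rw [hF _ (mem_image_of_mem G hu) _ (mem_image_of_mem G hv),
        integral_of_le (hmono.monotoneOn hu hv huv), integral_of_le huv,
        ← integral_Icc_eq_integral_Ioc, ← integral_Icc_eq_integral_Ioc, ← himg,
        integral_image_eq_integral_abs_deriv_smul measurableSet_Icc
          (fun x hx => (hG x (hsub hx)).hasDerivWithinAt) (hmono.injOn.mono hsub)]
      exact setIntegral_congr_fun measurableSet_Icc fun x hx => habs x (hsub hx)
    intro u hu v hv
    rcases le_total u v with huv | huv
    · exact key u hu v hv huv
    · rw [integral_symm, ← key v hv u hu huv, neg_sub]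

end IsLebesguePrimitiveOn

/-- Variation is superadditive over pairwise disjoint order-connected sets. -/
theorem eVariationOn.sum_le_biUnion_of_disjoint {ι : Type*} (g : ℝ → ℝ) (S : Finset ι)
    (J : ι → Set ℝ) (l : ι → ℝ) (hl : ∀ k ∈ S, IsLeast (J k) (l k))
    (hJ : ∀ k ∈ S, (J k).OrdConnected)
    (hdisj : ∀ j ∈ S, ∀ k ∈ S, j ≠ k → Disjoint (J j) (J k)) :
    ∑ k ∈ S, eVariationOn g (J k) ≤ eVariationOn g (⋃ k ∈ S, J k) := by
  classical
  induction S using Finset.induction_on_max_value l with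
  | empty => simp
  | insert m S hm hmax ih =>
    have hsub : ∀ k ∈ S, k ∈ insert m S := fun k hk => Finset.mem_insert_of_mem hk
    have hmm : m ∈ insert m S := Finset.mem_insert_self m S
    rw [Finset.sum_insert hm, Finset.set_biUnion_insert, union_comm, add_comm]
    refine (add_le_add_left (ih (fun k hk => hl k (hsub k hk)) (fun k hk => hJ k (hsub k hk))
      fun j hj k hk => hdisj j (hsub j hj) k (hsub k hk)) _).trans
      (eVariationOn.add_le_union g fun x hx y hy => ?_)
    obtain ⟨k, hk, hxk⟩ := mem_iUnion₂.1 hx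
    by_contra! hlt
    have hmem : l m ∈ J k := (hJ k (hsub k hk)).out (hl k (hsub k hk)).1 hxk
      ⟨hmax k hk, ((hl m hmm).2 hy).trans hlt.le⟩
    have hne : k ≠ m := by rintro rfl; exact hm hk
    exact (hdisj k (hsub k hk) m hmm hne).le_bot ⟨hmem, (hl m hmm).1⟩

/-- The derivative of the `s`-th iterate of `f` along the orbit of `x`, where `D` is the
derivative of `f`. -/
noncomputable def orbitDeriv (f D : ℝ → ℝ) (s : ℕ) (x : ℝ) : ℝ :=
  ∏ k ∈ Finset.range s, D (f^[k] x)

/-- The logarithmic derivative of `orbitDeriv`. -/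
noncomputable def orbitNonlinearity (f D D' : ℝ → ℝ) (s : ℕ) (x : ℝ) : ℝ :=
  ∑ k ∈ Finset.range s, D' (f^[k] x) / D (f^[k] x) * orbitDeriv f D k x

theorem hasDerivAt_iterate_orbitDeriv {f D : ℝ → ℝ} {x : ℝ} {s : ℕ}
    (h : ∀ k < s, HasDerivAt f (D (f^[k] x)) (f^[k] x)) :
    HasDerivAt f^[s] (orbitDeriv f D s x) x := by
  induction s with
  | zero => simpa [orbitDeriv] using hasDerivAt_id x
  | succ s ih =>
    rw [Function.iterate_succ', orbitDeriv, Finset.prod_range_succ, mul_comm]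
    exact (h s s.lt_succ_self).comp x (ih fun k hk => h k (hk.trans s.lt_succ_self))

/-- A function of bounded variation on a measurable set is a.e. measurable there. -/
theorem BoundedVariationOn.aemeasurable_restrict {g : ℝ → ℝ} {s : Set ℝ}
    (hg : BoundedVariationOn g s) (hs : MeasurableSet s) : AEMeasurable g (volume.restrict s) := by
  obtain ⟨p, r, hp, hr, rfl⟩ := hg.locallyBoundedVariationOn.exists_monotoneOn_sub_monotoneOn
  exact (aemeasurable_restrict_of_monotoneOn hs hp).sub (aemeasurable_restrict_of_monotoneOn hs hr)

/-- If `log D` has bounded variation on `s`, then dividing by `D` preserves integrability. -/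
theorem MeasureTheory.IntegrableOn.div_of_boundedVariationOn_log {D h : ℝ → ℝ} {s : Set ℝ}
    (hs : MeasurableSet s) (hpos : ∀ t ∈ s, 0 < D t)
    (hD : BoundedVariationOn (fun t => Real.log (D t)) s) (hh : IntegrableOn h s) :
    IntegrableOn (fun t => h t / D t) s := by
  rcases s.eq_empty_or_nonempty with rfl | ⟨c, hc⟩
  · simp
  have hinv : ∀ t ∈ s, Real.exp (-Real.log (D t)) = (D t)⁻¹ := fun t ht => by
    rw [Real.exp_neg, Real.exp_log (hpos t ht)]
  have hmeas : AEMeasurable (fun t => Real.exp (-Real.log (D t))) (volume.restrict s) :=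
    Real.measurable_exp.comp_aemeasurable (hD.aemeasurable_restrict hs).neg
  obtain ⟨M, hM⟩ : ∃ M, ∀ t ∈ s, dist (Real.log (D c)) (Real.log (D t)) ≤ M :=
    ⟨_, fun t ht => hD.dist_le hc ht⟩
  have hbound : ∀ᵐ t ∂volume.restrict s,
      ‖Real.exp (-Real.log (D t))‖ ≤ Real.exp (M - Real.log (D c)) := by
    refine (ae_restrict_iff' hs).2 (ae_of_all _ fun t ht => ?_)
    rw [Real.norm_eq_abs, Real.abs_exp, Real.exp_le_exp]
    have := (abs_le.1 (Real.dist_eq _ _ ▸ hM t ht)).2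
    linarith
  refine IntegrableOn.congr_fun (hh.mul_bdd hmeas.aestronglyMeasurable hbound) (fun t ht => ?_) hs
  simp only [hinv t ht, div_eq_mul_inv]

theorem orbitDeriv_isLebesguePrimitiveOn {f D D' : ℝ → ℝ} {a b : ℝ} {s : ℕ}
    (hprim : ∀ k < s, IsLebesguePrimitiveOn (fun x => D (f^[k] x))
      (fun x => D' (f^[k] x) * orbitDeriv f D k x) a b)
    (hpos : ∀ k < s, ∀ x ∈ Icc a b, 0 < D (f^[k] x)) :
    IsLebesguePrimitiveOn (orbitDeriv f D s)
      (fun x => orbitDeriv f D s x * orbitNonlinearity f D D' s x) a b := by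
  induction s with
  | zero => simp [IsLebesguePrimitiveOn, orbitDeriv, orbitNonlinearity]
  | succ s ih =>
    have hs := s.lt_succ_self
    have hmul := (ih (fun k hk => hprim k (hk.trans hs)) fun k hk => hpos k (hk.trans hs)).mul
      (hprim s hs)
    have hP : orbitDeriv f D (s + 1) = fun x => orbitDeriv f D s x * D (f^[s] x) := by
      funext x
      exact Finset.prod_range_succ _ _
    have heq : ∀ x ∈ Icc a b,
        orbitDeriv f D s x * orbitNonlinearity f D D' s x * D (f^[s] x) +
          orbitDeriv f D s x * (D' (f^[s] x) * orbitDeriv f D s x) =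
        orbitDeriv f D (s + 1) x * orbitNonlinearity f D D' (s + 1) x := by
      intro x hx
      have := (hpos s hs x hx).ne'
      rw [hP, orbitNonlinearity, orbitNonlinearity, Finset.sum_range_succ]
      field_simp
    refine ⟨hmul.1.congr_fun heq measurableSet_Icc, fun u hu v hv => ?_⟩
    rw [hP, hmul.2 u hu v hv, ← hP]
    exact intervalIntegral.integral_congr fun x hx => heq x (uIcc_subset_Icc hu hv hx)

/-- Bounded distortion of iterates along pairwise disjoint intervals. -/
theorem orbitDeriv_le_exp_mul_orbitDeriv {f D : ℝ → ℝ} {a b θ : ℝ} {s : ℕ} {I : Set ℝ}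
    (hθ : 0 ≤ θ) (hpos : ∀ t ∈ I, 0 < D t)
    (hvar : eVariationOn (fun t => Real.log (D t)) I ≤ ENNReal.ofReal θ)
    (hsub : ∀ k < s, f^[k] '' Icc a b ⊆ I)
    (hleast : ∀ k < s, IsLeast (f^[k] '' Icc a b) (f^[k] a))
    (hord : ∀ k < s, (f^[k] '' Icc a b).OrdConnected)
    (hdisj : ∀ j < s, ∀ k < s, j ≠ k → Disjoint (f^[j] '' Icc a b) (f^[k] '' Icc a b))
    {x y : ℝ} (hx : x ∈ Icc a b) (hy : y ∈ Icc a b) :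
    orbitDeriv f D s x ≤ Real.exp θ * orbitDeriv f D s y := by
  have hexp : ∀ z ∈ Icc a b,
      orbitDeriv f D s z = Real.exp (∑ k ∈ Finset.range s, Real.log (D (f^[k] z))) := by
    intro z hz
    rw [Real.exp_sum, orbitDeriv]
    refine Finset.prod_congr rfl fun k hk => (Real.exp_log (hpos _ ?_)).symm
    exact hsub k (Finset.mem_range.1 hk) (mem_image_of_mem _ hz)
  have hdist : ∑ k ∈ Finset.range s,
      dist (Real.log (D (f^[k] x))) (Real.log (D (f^[k] y))) ≤ θ := by
    rw [← ENNReal.ofReal_le_ofReal_iff hθ, ENNReal.ofReal_sum_of_nonneg fun _ _ => dist_nonneg]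
    calc ∑ k ∈ Finset.range s,
          ENNReal.ofReal (dist (Real.log (D (f^[k] x))) (Real.log (D (f^[k] y))))
        ≤ ∑ k ∈ Finset.range s,
          eVariationOn (fun t => Real.log (D t)) (f^[k] '' Icc a b) := by
          refine Finset.sum_le_sum fun k _ => ?_
          rw [← edist_dist]
          exact eVariationOn.edist_le (fun t => Real.log (D t))
            (mem_image_of_mem _ hx) (mem_image_of_mem _ hy)
      _ ≤ eVariationOn (fun t => Real.log (D t))
          (⋃ k ∈ Finset.range s, f^[k] '' Icc a b) := by
          refine eVariationOn.sum_le_biUnion_of_disjoint _ _ _ (fun k => f^[k] a) ?_ ?_ ?_ <;>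
            simpa only [Finset.mem_range]
      _ ≤ eVariationOn (fun t => Real.log (D t)) I :=
          eVariationOn.mono _ (iUnion₂_subset fun k hk => hsub k (Finset.mem_range.1 hk))
      _ ≤ ENNReal.ofReal θ := hvar
  rw [hexp x hx, hexp y hy, ← Real.exp_add, Real.exp_le_exp, ← sub_le_iff_le_add,
    ← Finset.sum_sub_distrib]
  exact (Finset.sum_le_sum fun k _ => (le_abs_self _).trans (Real.dist_eq _ _).ge).trans hdist

/-- The `L¹` norm of the nonlinearity of an iterate is controlled by that of the map, as long as
the iterated intervals are pairwise disjoint. -/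
theorem integral_abs_orbitNonlinearity_le {f D D' : ℝ → ℝ} {a b : ℝ} {s : ℕ} {I : Set ℝ}
    (hintg : IntegrableOn (fun t => D' t / D t) I)
    (hsub : ∀ k < s, f^[k] '' Icc a b ⊆ I)
    (hmeas : ∀ k < s, MeasurableSet (f^[k] '' Icc a b))
    (hinj : ∀ k < s, InjOn f^[k] (Icc a b))
    (hpos : ∀ k < s, ∀ x ∈ Icc a b, 0 ≤ orbitDeriv f D k x)
    (hderiv : ∀ k < s, ∀ x ∈ Icc a b, HasDerivAt f^[k] (orbitDeriv f D k x) x)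
    (hdisj : ∀ j < s, ∀ k < s, j ≠ k → Disjoint (f^[j] '' Icc a b) (f^[k] '' Icc a b)) :
    IntegrableOn (orbitNonlinearity f D D' s) (Icc a b) ∧
      ∫ x in Icc a b, |orbitNonlinearity f D D' s x| ≤ ∫ t in I, |D' t / D t| := by
  have hterm : ∀ k < s, IntegrableOn
      (fun x => |orbitDeriv f D k x| • |D' (f^[k] x) / D (f^[k] x)|) (Icc a b) := fun k hk =>
    (integrableOn_image_iff_integrableOn_abs_deriv_smul measurableSet_Icc
      (fun x hx => (hderiv k hk x hx).hasDerivWithinAt) (hinj k hk) fun t => |D' t / D t|).1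
      (hintg.mono_set (hsub k hk)).abs
  have hterm' : ∀ k < s, IntegrableOn
      (fun x => D' (f^[k] x) / D (f^[k] x) * orbitDeriv f D k x) (Icc a b) := fun k hk =>
    ((integrableOn_image_iff_integrableOn_abs_deriv_smul measurableSet_Icc
      (fun x hx => (hderiv k hk x hx).hasDerivWithinAt) (hinj k hk) fun t => D' t / D t).1
      (hintg.mono_set (hsub k hk))).congr_fun
      (fun x hx => by simp only [abs_of_nonneg (hpos k hk x hx), smul_eq_mul, mul_comm])
      measurableSet_Icc
  have hsum : IntegrableOn (orbitNonlinearity f D D' s) (Icc a b) :=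
    integrable_finsetSum _ fun k hk => hterm' k (Finset.mem_range.1 hk)
  refine ⟨hsum, ?_⟩
  calc ∫ x in Icc a b, |orbitNonlinearity f D D' s x|
      ≤ ∫ x in Icc a b, ∑ k ∈ Finset.range s,
          |orbitDeriv f D k x| • |D' (f^[k] x) / D (f^[k] x)| := by
        refine setIntegral_mono hsum.abs
          (integrable_finsetSum _ fun k hk => hterm k (Finset.mem_range.1 hk)) fun x => ?_
        refine (Finset.abs_sum_le_sum_abs _ _).trans_eq (Finset.sum_congr rfl fun k _ => ?_)
        rw [abs_mul, smul_eq_mul, mul_comm]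
    _ = ∑ k ∈ Finset.range s, ∫ t in f^[k] '' Icc a b, |D' t / D t| := by
        rw [integral_finsetSum _ fun k hk => hterm k (Finset.mem_range.1 hk)]
        refine Finset.sum_congr rfl fun k hk => ?_
        have hk := Finset.mem_range.1 hk
        exact (integral_image_eq_integral_abs_deriv_smul measurableSet_Icc
          (fun x hx => (hderiv k hk x hx).hasDerivWithinAt) (hinj k hk) fun t => |D' t / D t|).symm
    _ = ∫ t in ⋃ k ∈ Finset.range s, f^[k] '' Icc a b, |D' t / D t| := by
        refine (integral_biUnion_finset _ (fun k hk => hmeas k (Finset.mem_range.1 hk))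
          (fun j hj k hk hjk => hdisj j ?_ k ?_ hjk)
          fun k hk => (hintg.mono_set (hsub k (Finset.mem_range.1 hk))).abs).symm
        · simpa using hj
        · simpa using hk
    _ ≤ ∫ t in I, |D' t / D t| :=
        setIntegral_mono_set hintg.abs (ae_of_all _ fun t => abs_nonneg _)
          (iUnion₂_subset fun k hk => hsub k (Finset.mem_range.1 hk)).eventuallyLE

/-- For every `θ ≥ 0` there is a constant `C` (depending only on `θ`)
such that for any map `f : I → I`, interval `[a,b] ⊆ I = [0,1)` whose first `q` iterates
under `f` are pairwise disjoint, with `f` differentiable on the iterated intervals with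
derivative `D` (positive on `I`, `log D` of variation `≤ θ`), `D` absolutely continuous on
each iterated interval with a.e. derivative `D'` integrable on `I`, the relative coordinate
map `φ_i(z₀) = (f^i(a + z₀(b-a)) - f^i(a))/(f^i(b) - f^i(a))` has an absolutely continuous
first derivative and `∫₀¹ |φ_i''| ≤ C ∫_I |D'/D|`. -/
theorem second_derivative_relative_coordinate_L1_bound
    (θ : ℝ) (hθ : 0 ≤ θ) :
    ∃ C : ℝ, 0 < C ∧
      ∀ (f D D' : ℝ → ℝ) (a b : ℝ) (q : ℕ),
        MapsTo f (Ico (0:ℝ) 1) (Ico (0:ℝ) 1) →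
        a < b → Icc a b ⊆ Ico (0:ℝ) 1 → 1 ≤ q →
        (∀ t ∈ Ico (0:ℝ) 1, 0 < D t) →
        eVariationOn (fun t => Real.log (D t)) (Ico (0:ℝ) 1) ≤ ENNReal.ofReal θ →
        (∀ s < q, ∀ t ∈ f^[s] '' Icc a b, HasDerivAt f (D t) t) →
        (∀ s < q, ∀ u ∈ f^[s] '' Icc a b, ∀ v ∈ f^[s] '' Icc a b,
          D v - D u = ∫ t in u..v, D' t) →
        MeasureTheory.IntegrableOn D' (Ico (0:ℝ) 1) →
        (∀ s < q, ∀ t < q, s ≠ t →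
          Disjoint (f^[s] '' Icc a b) (f^[t] '' Icc a b)) →
        ∀ i < q,
          ∃ φ' φ'' : ℝ → ℝ,
            (∀ z ∈ Icc (0:ℝ) 1,
              HasDerivWithinAt
                (fun z0 : ℝ => (f^[i] (a + z0 * (b - a)) - f^[i] a) / (f^[i] b - f^[i] a))
                (φ' z) (Icc (0:ℝ) 1) z) ∧
            (∀ u ∈ Icc (0:ℝ) 1, ∀ v ∈ Icc (0:ℝ) 1,
              φ' v - φ' u = ∫ t in u..v, φ'' t) ∧
            (∫ z in (0:ℝ)..1, |φ'' z|) ≤ C * ∫ t in Ico (0:ℝ) 1, |D' t / D t| := by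
  refine ⟨Real.exp θ, Real.exp_pos θ, ?_⟩
  intro f D D' a b q hmaps hab hsub hq hpos hvar hderiv hD hintg hdisj i hi
  have hL : 0 < b - a := sub_pos.2 hab
  have hsubI : ∀ k, f^[k] '' Icc a b ⊆ Ico (0 : ℝ) 1 := fun k =>
    image_subset_iff.2 fun x hx => hmaps.iterate k (hsub hx)
  have hDpos : ∀ k, ∀ x ∈ Icc a b, 0 < D (f^[k] x) := fun k x hx =>
    hpos _ (hsubI k (mem_image_of_mem _ hx))
  have hPpos : ∀ k, ∀ x ∈ Icc a b, 0 < orbitDeriv f D k x := fun k x hx =>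
    Finset.prod_pos fun j _ => hDpos j x hx
  have hP : ∀ k < q, ∀ x ∈ Icc a b, HasDerivAt f^[k] (orbitDeriv f D k x) x := fun k hk x hx =>
    hasDerivAt_iterate_orbitDeriv fun j hj => hderiv j (hj.trans hk) _ (mem_image_of_mem _ hx)
  have hcont : ∀ k < q, ContinuousOn f^[k] (Icc a b) := fun k hk x hx =>
    (hP k hk x hx).continuousAt.continuousWithinAt
  have hmono : ∀ k < q, StrictMonoOn f^[k] (Icc a b) := fun k hk =>
    strictMonoOn_of_deriv_pos (convex_Icc a b) (hcont k hk) fun x hx => by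
      rw [(hP k hk x (interior_subset hx)).deriv]
      exact hPpos k x (interior_subset hx)
  have himg : ∀ k < q, f^[k] '' Icc a b = Icc (f^[k] a) (f^[k] b) := fun k hk =>
    (hcont k hk).image_Icc_of_monotoneOn hab.le (hmono k hk).monotoneOn
  have hle : ∀ k < q, f^[k] a ≤ f^[k] b := fun k hk =>
    (hmono k hk).monotoneOn (left_mem_Icc.2 hab.le) (right_mem_Icc.2 hab.le) hab.le
  have hbv : BoundedVariationOn (fun t => Real.log (D t)) (Ico (0 : ℝ) 1) :=
    (hvar.trans_lt ENNReal.ofReal_lt_top).ne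
  have hquot : IntegrableOn (fun t => D' t / D t) (Ico (0 : ℝ) 1) :=
    hintg.div_of_boundedVariationOn_log measurableSet_Ico hpos hbv
  have hprim := orbitDeriv_isLebesguePrimitiveOn (s := i) (f := f) (D := D) (D' := D') (a := a)
    (b := b) (fun k hk => IsLebesguePrimitiveOn.comp_strictMonoOn (hP k (hk.trans hi)) (hPpos k)
      (hmono k (hk.trans hi)) (hintg.mono_set (hsubI k)) (hD k (hk.trans hi)))
    (fun k _ => hDpos k)
  obtain ⟨hNint, hNle⟩ := integral_abs_orbitNonlinearity_le (s := i) hquot (fun k _ => hsubI k)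
    (fun k hk => himg k (hk.trans hi) ▸ measurableSet_Icc)
    (fun k hk => (hmono k (hk.trans hi)).injOn)
    (fun k _ x hx => (hPpos k x hx).le) (fun k hk => hP k (hk.trans hi))
    (fun j hj k hk => hdisj j (hj.trans hi) k (hk.trans hi))
  obtain ⟨y, hy, hyslope⟩ := exists_hasDerivAt_eq_slope f^[i] (orbitDeriv f D i) hab (hcont i hi)
    fun x hx => hP i hi x (Ioo_subset_Icc_self hx)
  have hyI := Ioo_subset_Icc_self hy
  set Li := f^[i] b - f^[i] a with hLi
  have hLipos : 0 < Li := by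
    have := hPpos i y hyI
    rw [hyslope] at this
    exact (div_pos_iff_of_pos_right hL).1 this
  have hdist : ∀ x ∈ Icc a b, (b - a) / Li * orbitDeriv f D i x ≤ Real.exp θ := by
    intro x hx
    have := orbitDeriv_le_exp_mul_orbitDeriv (s := i) hθ hpos hvar (fun k _ => hsubI k)
      (fun k hk => himg k (hk.trans hi) ▸ isLeast_Icc (hle k (hk.trans hi)))
      (fun k hk => himg k (hk.trans hi) ▸ ordConnected_Icc)
      (fun j hj k hk => hdisj j (hj.trans hi) k (hk.trans hi)) hx hyI
    rw [hyslope] at this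
    rw [div_mul_eq_mul_div, div_le_iff₀ hLipos]
    calc (b - a) * orbitDeriv f D i x ≤ (b - a) * (Real.exp θ * (Li / (b - a))) := by gcongr
      _ = Real.exp θ * Li := by field_simp
  have hmem : ∀ z ∈ Icc (0 : ℝ) 1, a + (b - a) * z ∈ Icc a b := fun z hz =>
    ⟨by nlinarith [hz.1], by nlinarith [hz.2]⟩
  set Q : ℝ → ℝ := fun x => orbitDeriv f D i x * orbitNonlinearity f D D' i x with hQ
  refine ⟨fun z => (b - a) / Li * orbitDeriv f D i (a + (b - a) * z),
    fun z => (b - a) * ((b - a) / Li) * Q (a + (b - a) * z),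
    fun z hz => ?_, fun u hu v hv => ?_, ?_⟩
  · have haff : HasDerivAt (fun z0 : ℝ => a + z0 * (b - a)) (b - a) z := by
      simpa using ((hasDerivAt_id z).mul_const (b - a)).const_add a
    have hz' : a + z * (b - a) ∈ Icc a b := mul_comm (b - a) z ▸ hmem z hz
    have hcomp := (((hP i hi _ hz').comp z haff).sub_const (f^[i] a)).div_const Li
    refine hcomp.hasDerivWithinAt.congr_deriv ?_
    simp only [mul_comm (b - a) z]
    ring
  · rw [intervalIntegral.integral_const_mul, integral_comp_add_mul Q hL.ne',
      ← hprim.2 _ (hmem u hu) _ (hmem v hv), smul_eq_mul]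
    field_simp
  · calc ∫ z in (0 : ℝ)..1, |(b - a) * ((b - a) / Li) * Q (a + (b - a) * z)|
        = ∫ x in a..b, (b - a) / Li * |Q x| := by
          have h0 : 0 < (b - a) * ((b - a) / Li) := by positivity
          simp only [abs_mul _ (Q _), abs_of_pos h0]
          rw [intervalIntegral.integral_const_mul,
            integral_comp_add_mul (fun x => |Q x|) hL.ne', intervalIntegral.integral_const_mul,
            smul_eq_mul, mul_zero, add_zero, mul_one, add_sub_cancel]
          field_simp
      _ = ∫ x in Icc a b, (b - a) / Li * |Q x| := by
          rw [integral_of_le hab.le, integral_Icc_eq_integral_Ioc]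
      _ ≤ ∫ x in Icc a b, Real.exp θ * |orbitNonlinearity f D D' i x| := by
          refine setIntegral_mono_on (hprim.1.abs.const_mul _) (hNint.abs.const_mul _)
            measurableSet_Icc fun x hx => ?_
          rw [hQ, abs_mul, abs_of_pos (hPpos i x hx), ← mul_assoc]
          exact mul_le_mul_of_nonneg_right (hdist x hx) (abs_nonneg _)
      _ = Real.exp θ * ∫ x in Icc a b, |orbitNonlinearity f D D' i x| :=
          integral_const_mul _ _
      _ ≤ Real.exp θ * ∫ t in Ico (0 : ℝ) 1, |D' t / D t| := by gcongr
end

section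
/- Let a < b be reals and let f : [a,b] \to \mathbb{R} be differentiable with f' absolutely continuous on [a,b], f' > 0, and let f'' denote the almost-everywhere derivative of f' (which is integrable). Fix x \in (a,b) and set z = (x-a)/(b-a), z_1 = (f(x) - f(a))/(f(b) - f(a)), and A = \frac{ \frac{1}{f'(a)(x-a)} \int_a^x f''(t)(t-a)\,dt + \frac{1}{f'(a)(b-x)} \int_x^b f''(t)(b-t)\,dt }{ 1 + \frac{1}{f'(a)(b-a)} \int_a^b f''(t)(b-t)\,dt }. Then z_1 = z \, (1 + A(z-1)), and consequently \frac{1 - z_1}{z_1} = \frac{1-z}{z} \cdot \frac{1 + A z}{1 + A(z-1)} whenever 1 + A(z-1) \ne 0. -/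
open Set intervalIntegral

/-- Integration by parts against an affine function: if `f` has derivative `f'` on `[u, v]` and
`f'` is a primitive of the integrable function `f''`, then `∫ f''(t) (t - c)` over `[u, v]` is
computed from the boundary values of `f` and `f'`. -/
theorem integral_mul_sub_const_of_primitive {u v : ℝ} (huv : u ≤ v) {f f' f'' : ℝ → ℝ}
    (hderiv : ∀ t ∈ Icc u v, HasDerivWithinAt f (f' t) (Icc u v) t)
    (hprim : ∀ t ∈ Icc u v, f' t - f' u = ∫ s in u..t, f'' s)
    (hint : MeasureTheory.IntegrableOn f'' (Icc u v)) (c : ℝ) :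
    ∫ t in u..v, f'' t * (t - c) = f' v * (v - c) - f' u * (u - c) - (f v - f u) := by
  have hii : IntervalIntegrable f'' MeasureTheory.volume u v :=
    (intervalIntegrable_iff_integrableOn_Icc_of_le huv).2 hint
  have hF := hii.absolutelyContinuousOnInterval_intervalIntegral left_mem_uIcc
  have hlin : AbsolutelyContinuousOnInterval (fun t : ℝ => t - c) u v :=
    ContDiffOn.absolutelyContinuousOnInterval (by fun_prop)
  have hparts := hlin.integral_mul_deriv_eq_deriv_mul hF
  have hcongr : ∫ t in u..v, f'' t * (t - c) =
      ∫ t in u..v, (t - c) * deriv (fun y => ∫ s in u..y, f'' s) t := by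
    apply integral_congr_ae
    filter_upwards [hii.ae_hasDerivAt_integral] with t ht htm
    rw [(ht (uIoc_subset_uIcc htm) u left_mem_uIcc).deriv, mul_comm]
  have hf'cont : ContinuousOn f' (uIcc u v) := by
    refine (hF.continuousOn.add (continuousOn_const (c := f' u))).congr fun t ht => ?_
    rw [uIcc_of_le huv] at ht
    simp [← hprim t ht]
  have hf'int : IntervalIntegrable f' MeasureTheory.volume u v := hf'cont.intervalIntegrable
  have hftc : ∫ t in u..v, f' t = f v - f u :=
    integral_eq_sub_of_hasDerivAt_of_le huv (fun t ht => (hderiv t ht).continuousWithinAt)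
      (fun t ht => (hderiv t (Ioo_subset_Icc_self ht)).hasDerivAt (Icc_mem_nhds ht.1 ht.2)) hf'int
  have hintF : ∫ t in u..v, deriv (fun t : ℝ => t - c) t * ∫ s in u..t, f'' s =
      f v - f u - (v - u) * f' u := by
    rw [← hftc, ← smul_eq_mul, ← integral_const, ← integral_sub hf'int (by simp)]
    refine integral_congr fun t ht => ?_
    rw [uIcc_of_le huv] at ht
    simp [← hprim t ht]
  rw [hcongr, hparts, hintF, ← hprim v (right_mem_Icc.2 huv), integral_same]
  ring

/-- One-step relation between relative coordinates: for `f` with `f'`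
absolutely continuous and positive on `[a,b]`, `x ∈ (a,b)`, `z = (x-a)/(b-a)`,
`z₁ = (f(x)-f(a))/(f(b)-f(a))` and the quantity `A` defined by the integral formula,
one has `z₁ = z(1 + A(z-1))`, hence
`(1-z₁)/z₁ = ((1-z)/z) · (1+Az)/(1+A(z-1))` whenever `1 + A(z-1) ≠ 0`. -/
theorem one_step_relative_coordinate_relation
    (a b : ℝ) (hab : a < b) (f f' f'' : ℝ → ℝ)
    (hderiv : ∀ t ∈ Icc a b, HasDerivWithinAt f (f' t) (Icc a b) t)
    (hpos : ∀ t ∈ Icc a b, 0 < f' t)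
    (hAC : ∀ u ∈ Icc a b, ∀ v ∈ Icc a b, f' v - f' u = ∫ t in u..v, f'' t)
    (hint : MeasureTheory.IntegrableOn f'' (Icc a b))
    (x : ℝ) (hx : x ∈ Ioo a b)
    (z z1 A : ℝ)
    (hz : z = (x - a) / (b - a))
    (hz1 : z1 = (f x - f a) / (f b - f a))
    (hA : A =
      ((f' a * (x - a))⁻¹ * (∫ t in a..x, f'' t * (t - a)) +
        (f' a * (b - x))⁻¹ * (∫ t in x..b, f'' t * (b - t))) /
      (1 + (f' a * (b - a))⁻¹ * ∫ t in a..b, f'' t * (b - t))) :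
    z1 = z * (1 + A * (z - 1)) ∧
      (1 + A * (z - 1) ≠ 0 →
        (1 - z1) / z1 = (1 - z) / z * ((1 + A * z) / (1 + A * (z - 1)))) := by
  obtain ⟨hax, hxb⟩ := hx
  have key : ∀ u ∈ Icc a b, ∀ v ∈ Icc a b, u ≤ v → ∀ c : ℝ,
      ∫ t in u..v, f'' t * (t - c) = f' v * (v - c) - f' u * (u - c) - (f v - f u) := by
    intro u hu v hv huv c
    have hsub : Icc u v ⊆ Icc a b := Icc_subset_Icc hu.1 hv.2
    exact integral_mul_sub_const_of_primitive huv
      (fun t ht => (hderiv t (hsub ht)).mono hsub) (fun t ht => hAC u hu t (hsub ht))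
      (hint.mono_set hsub) c
  have key_rev : ∀ u ∈ Icc a b, ∀ v ∈ Icc a b, u ≤ v → ∀ c : ℝ,
      ∫ t in u..v, f'' t * (c - t) = f v - f u - (f' v * (v - c) - f' u * (u - c)) := by
    intro u hu v hv huv c
    rw [← neg_sub _ (f v - f u), ← key u hu v hv huv c, ← integral_neg]
    simp only [← mul_neg, neg_sub]
  have ha : a ∈ Icc a b := left_mem_Icc.2 hab.le
  have hb : b ∈ Icc a b := right_mem_Icc.2 hab.le
  have hxm : x ∈ Icc a b := ⟨hax.le, hxb.le⟩
  have hmono : StrictMonoOn f (Icc a b) :=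
    strictMonoOn_of_hasDerivWithinAt_pos (convex_Icc a b)
      (fun t ht => (hderiv t ht).continuousWithinAt)
      (fun t ht => (hderiv t (interior_subset ht)).mono interior_subset)
      (fun t ht => hpos t (interior_subset ht))
  have hfab : f b - f a ≠ 0 := (sub_pos.2 (hmono ha hb hab)).ne'
  have hf'a : f' a ≠ 0 := (hpos a ha).ne'
  have hxa : x - a ≠ 0 := (sub_pos.2 hax).ne'
  have hbx : b - x ≠ 0 := (sub_pos.2 hxb).ne'
  have hba : b - a ≠ 0 := (sub_pos.2 hab).ne'
  have hden : 1 + (f' a * (b - a))⁻¹ * ∫ t in a..b, f'' t * (b - t) =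
      (f b - f a) / (f' a * (b - a)) := by
    rw [key_rev a ha b hb hab.le]
    field_simp
    ring
  have hnum : (f' a * (x - a))⁻¹ * (∫ t in a..x, f'' t * (t - a)) +
      (f' a * (b - x))⁻¹ * (∫ t in x..b, f'' t * (b - t)) =
      ((f b - f x) / (b - x) - (f x - f a) / (x - a)) / f' a := by
    rw [key a ha x hxm hax.le, key_rev x hxm b hb hxb.le]
    field_simp
    ring
  have hmain : z1 = z * (1 + A * (z - 1)) := by
    rw [hz1, hz, hA, hden, hnum]
    field_simp
    ring
  refine ⟨hmain, fun hne => ?_⟩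
  rw [hmain, div_mul_div_comm]
  congr 1
  ring
end
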